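/- arXiv:1307.2262 — 5 statements merged into one kernel-verified Lean document; each statement's English description precedes it below -/
import Mathlib

section
/- For every integer k ≥ 3 and every real ε > 0 there exist a constant c > 0 and a threshold n₀ ∈ ℕ such that the following holds. Let 𝒮 be a finite family of k-element sets with |𝒮| = n ≥ n₀, and let 𝒜 ⊆ 𝒮 be a packing with the property that for every packing 𝒫 ⊆ 𝒮 \ 𝒜 with 1 ≤ |𝒫| ≤ c·log n, the number of sets in 𝒜 that intersect at least one member of 𝒫 is at least |𝒫| (i.e., 𝒜 admits no local improvement of size at most c·log n). Then every packing ℬ ⊆ 𝒮 satisfies |ℬ| ≤ ((k+1)/3 + ε)·|𝒜|. -/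
open Finset

/-- The family `N b`, `b ∈ B`, of sets satisfies Hall's condition for all subfamilies of size at
most `L`. -/
def HallUpTo {α β : Type*} [DecidableEq α] (N : β → Finset α) (B : Finset β) (L : ℕ) : Prop :=
  ∀ P ⊆ B, P.card ≤ L → P.card ≤ (P.biUnion N).card

/-- The ball of radius `r` around `v` in the hypergraph with edges `N e`, `e ∈ E`. -/
def edgeBall {α β : Type*} [DecidableEq α] (N : β → Finset α) (E : Finset β) (v : α) :
    ℕ → Finset α
  | 0 => {v}
  | r + 1 => edgeBall N E v r ∪ (E.filter fun e => ¬ Disjoint (N e) (edgeBall N E v r)).biUnion N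

section

variable {α β : Type*} [DecidableEq α]

lemma HallUpTo.mono {N : β → Finset α} {B B' : Finset β} {L L' : ℕ}
    (h : HallUpTo N B L) (hB : B' ⊆ B) (hL : L' ≤ L) : HallUpTo N B' L' :=
  fun P hP hPL => h P (hP.trans hB) (hPL.trans hL)

lemma edgeBall_subset {N : β → Finset α} {E : Finset β} {v : α} {W : Finset α}
    (hv : v ∈ W) (hE : ∀ e ∈ E, N e ⊆ W) (r : ℕ) : edgeBall N E v r ⊆ W := by
  induction r with
  | zero => simpa [edgeBall] using hv
  | succ r ih =>
    refine union_subset ih (biUnion_subset.2 fun e he => hE e (mem_filter.1 he).1)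

lemma mem_edgeBall_self (N : β → Finset α) (E : Finset β) (v : α) (r : ℕ) :
    v ∈ edgeBall N E v r := by
  induction r with
  | zero => simp [edgeBall]
  | succ r ih => exact mem_union_left _ ih

lemma three_mul_card_le {N : β → Finset α} {A : Finset α} {B : Finset β} {k : ℕ}
    (hNA : ∀ b ∈ B, N b ⊆ A) (hN : ∀ b ∈ B, (N b).Nonempty)
    (hA : ∀ a ∈ A, (B.filter fun b => a ∈ N b).card ≤ k) :
    3 * B.card ≤ k * A.card + (B.filter fun b => (N b).card = 1).card +
      (B.filter fun b => (N b).card ≤ 2).card := by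
  have hsum : ∑ b ∈ B, (N b).card ≤ k * A.card := by
    have h1 : ∑ b ∈ B, (N b).card = ∑ a ∈ A, (B.filter fun b => a ∈ N b).card := by
      refine Eq.trans (sum_congr rfl fun b hb => ?_)
        (sum_card_bipartiteAbove_eq_sum_card_bipartiteBelow fun a b => a ∈ N b).symm
      rw [bipartiteBelow, filter_mem_eq_inter, inter_eq_right.2 (hNA b hb)]
    rw [h1, mul_comm]
    exact sum_le_card_nsmul A _ k hA
  rw [card_filter, card_filter]
  calc 3 * B.card = ∑ b ∈ B, 3 := by rw [sum_const, smul_eq_mul, mul_comm]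
    _ ≤ ∑ b ∈ B, ((N b).card + (if (N b).card = 1 then 1 else 0) +
        (if (N b).card ≤ 2 then 1 else 0)) := by
      refine sum_le_sum fun b hb => ?_
      have := card_pos.2 (hN b hb)
      split_ifs <;> omega
    _ ≤ _ := by
      rw [sum_add_distrib, sum_add_distrib]
      omega

variable [DecidableEq β]

/-- A breadth-first search tree of a multigraph: a set `T` of edges inside the ball of radius `r`
such that any set `Y` of vertices is contained in a subtree with at most `r * |Y|` edges. -/
lemma exists_bfs_tree [Nonempty β] (N : β → Finset α) (E : Finset β) (v : α)
    (hN : ∀ e ∈ E, (N e).card ≤ 2) (r : ℕ) :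
    ∃ T ⊆ E, T.card + 1 ≤ (edgeBall N E v r).card ∧
      ∀ Y ⊆ edgeBall N E v r, ∃ X ⊆ edgeBall N E v r, Y ⊆ X ∧ ∃ F ⊆ T,
        X.card ≤ F.card + 1 ∧ F.biUnion N ⊆ X ∧ F.card ≤ r * Y.card := by
  induction r with
  | zero =>
    refine ⟨∅, empty_subset _, by simp [edgeBall], fun Y hY => ⟨{v}, by simp [edgeBall], ?_, ∅,
      empty_subset _, by simp, by simp, by simp⟩⟩
    simpa [edgeBall] using hY
  | succ r ih =>
    obtain ⟨T, hTE, hT, hIH⟩ := ih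
    set D := edgeBall N E v r
    set D' := edgeBall N E v (r + 1)
    have hDD' : D ⊆ D' := subset_union_left
    have hpar : ∀ u ∈ D' \ D, ∃ e ∈ E, ∃ w ∈ D, u ∈ N e ∧ w ∈ N e := by
      intro u hu
      rw [mem_sdiff] at hu
      rcases mem_union.1 hu.1 with h | h
      · exact absurd h hu.2
      · obtain ⟨e, he, hue⟩ := mem_biUnion.1 h
        obtain ⟨heE, hed⟩ := mem_filter.1 he
        obtain ⟨w, hw1, hw2⟩ := not_disjoint_iff.1 hed
        exact ⟨e, heE, w, hw2, hue, hw1⟩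
    have hNe : ∀ u ∈ D' \ D, ∃ e ∈ E, ∃ w ∈ D, N e = {u, w} := by
      intro u hu
      obtain ⟨e, he, w, hw, hue, hwe⟩ := hpar u hu
      refine ⟨e, he, w, hw, ?_⟩
      have huw : u ≠ w := by
        rintro rfl
        exact (mem_sdiff.1 hu).2 hw
      refine (eq_of_subset_of_card_le ?_ ?_).symm
      · intro x hx
        rcases mem_insert.1 hx with rfl | hx
        · exact hue
        · rwa [mem_singleton.1 hx]
      · rw [card_pair huw]
        exact hN e he
    choose! p hpE q hqD hpN using hNe
    have hpT : ∀ u ∈ D' \ D, ∀ F : Finset β, F.biUnion N ⊆ D → p u ∉ F := by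
      intro u hu F hF hmem
      refine (mem_sdiff.1 hu).2 (hF (mem_biUnion.2 ⟨p u, hmem, ?_⟩))
      rw [hpN u hu]
      exact mem_insert_self _ _
    have hpinj : Set.InjOn p (D' \ D : Finset α) := by
      intro u hu w hw h
      have hu' := mem_coe.1 hu
      have hw' := mem_coe.1 hw
      have h1 : u ∈ N (p w) := by
        rw [← h, hpN u hu']
        exact mem_insert_self _ _
      rw [hpN w hw', mem_insert, mem_singleton] at h1
      rcases h1 with h1 | h1
      · exact h1
      · exact absurd (h1 ▸ hqD w hw') (mem_sdiff.1 hu').2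
    refine ⟨T ∪ (D' \ D).image p, union_subset hTE (image_subset_iff.2 hpE), ?_, ?_⟩
    · have h1 := card_union_le T ((D' \ D).image p)
      have h2 : ((D' \ D).image p).card ≤ (D' \ D).card := card_image_le
      have h3 := card_sdiff_add_card_eq_card hDD'
      omega
    · intro Y hY
      have hYn : Y \ D ⊆ D' \ D := sdiff_subset_sdiff hY subset_rfl
      obtain ⟨X, hXD, hYX, F, hFT, hXF, hFX, hFr⟩ := hIH (Y ∩ D ∪ (Y \ D).image q)
        (union_subset inter_subset_right (image_subset_iff.2 fun u hu => hqD u (hYn hu)))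
      have hYcard : (Y ∩ D ∪ (Y \ D).image q).card ≤ Y.card := by
        have h1 := card_union_le (Y ∩ D) ((Y \ D).image q)
        have h2 : ((Y \ D).image q).card ≤ (Y \ D).card := card_image_le
        have h3 := card_inter_add_card_sdiff Y D
        omega
      have hFcard : (F ∪ (Y \ D).image p).card = F.card + (Y \ D).card := by
        rw [card_union_of_disjoint, card_image_of_injOn (hpinj.mono (by exact_mod_cast hYn))]
        rw [disjoint_right]
        intro e he
        obtain ⟨u, hu, rfl⟩ := mem_image.1 he
        exact hpT u (hYn hu) F (hFX.trans hXD)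
      refine ⟨X ∪ Y \ D, union_subset (hXD.trans hDD') (sdiff_subset.trans hY), ?_,
        F ∪ (Y \ D).image p, union_subset_union hFT (image_subset_image hYn), ?_, ?_, ?_⟩
      · intro y hy
        by_cases hyD : y ∈ D
        · exact mem_union_left _ (hYX (mem_union_left _ (mem_inter.2 ⟨hy, hyD⟩)))
        · exact mem_union_right _ (mem_sdiff.2 ⟨hy, hyD⟩)
      · have := card_union_le X (Y \ D)
        omega
      · rw [union_biUnion]
        refine union_subset (hFX.trans subset_union_left) ?_
        rw [image_biUnion]
        refine biUnion_subset.2 fun u hu => ?_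
        rw [hpN u (hYn hu)]
        refine insert_subset (mem_union_right _ hu) (singleton_subset_iff.2 (mem_union_left _ ?_))
        exact hYX (mem_union_right _ (mem_image_of_mem q hu))
      · have h1 : (Y \ D).card ≤ Y.card := card_le_card sdiff_subset
        have h2 : r * (Y ∩ D ∪ (Y \ D).image q).card ≤ r * Y.card := Nat.mul_le_mul_left r hYcard
        rw [hFcard, Nat.succ_mul]
        omega

/-- A ball containing more edges than vertices contains a small set of edges spanning fewer
vertices than its size. -/
lemma exists_card_biUnion_lt_of_edgeBall (N : β → Finset α) (E : Finset β) (v : α)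
    (hN : ∀ e ∈ E, (N e).card ≤ 2) (r : ℕ)
    (h : (edgeBall N E v r).card < (E.filter fun e => N e ⊆ edgeBall N E v r).card) :
    ∃ P ⊆ E, P.card ≤ 4 * r + 2 ∧ (P.biUnion N).card < P.card := by
  set D := edgeBall N E v r
  have hne : Nonempty β := by
    obtain ⟨e, -⟩ := card_pos.1 (Nat.zero_lt_of_lt h)
    exact ⟨e⟩
  obtain ⟨T, hTE, hT, htree⟩ := exists_bfs_tree N E v hN r
  have hgap : 1 < ((E.filter fun e => N e ⊆ D) \ T).card := by
    have := le_card_sdiff T (E.filter fun e => N e ⊆ D)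
    change T.card + 1 ≤ D.card at hT
    omega
  obtain ⟨e, he, f, hf, hef⟩ := one_lt_card.1 hgap
  obtain ⟨he, heT⟩ := mem_sdiff.1 he
  obtain ⟨hf, hfT⟩ := mem_sdiff.1 hf
  obtain ⟨heE, heD⟩ := mem_filter.1 he
  obtain ⟨hfE, hfD⟩ := mem_filter.1 hf
  obtain ⟨X, -, hYX, F, hFT, hXF, hFX, hFr⟩ := htree (N e ∪ N f) (union_subset heD hfD)
  have hY : (N e ∪ N f).card ≤ 4 := by
    have := card_union_le (N e) (N f)
    have := hN e heE
    have := hN f hfE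
    omega
  have hcard : (insert e (insert f F)).card = F.card + 2 := by
    rw [card_insert_of_notMem, card_insert_of_notMem fun h => hfT (hFT h)]
    rw [mem_insert, not_or]
    exact ⟨hef, fun h => heT (hFT h)⟩
  refine ⟨insert e (insert f F),
    insert_subset heE (insert_subset hfE (hFT.trans hTE)), ?_, ?_⟩
  · have : r * (N e ∪ N f).card ≤ r * 4 := Nat.mul_le_mul_left r hY
    omega
  · have : (insert e (insert f F)).biUnion N ⊆ X := by
      rw [biUnion_insert, biUnion_insert]
      exact union_subset (subset_union_left.trans hYX)
        (union_subset (subset_union_right.trans hYX) hFX)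
    have := card_le_card this
    omega

/-- In a multigraph where every nonempty set `U` of vertices meets more than `(1 + δ) |U|` edges,
some set of logarithmically many edges spans fewer vertices than its size. -/
lemma exists_card_biUnion_lt_of_expansion (N : β → Finset α) (E : Finset β) (W : Finset α)
    (hN : ∀ e ∈ E, (N e).card ≤ 2) (hEW : ∀ e ∈ E, N e ⊆ W) (hW : W.Nonempty)
    {δ : ℝ} (hδ : 0 < δ) {R : ℕ} (hR : (W.card : ℝ) < (1 + δ) ^ R)
    (hexp : ∀ U ⊆ W, U.Nonempty →
      (1 + δ) * U.card < (E.filter fun e => ¬ Disjoint (N e) U).card) :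
    ∃ P ⊆ E, P.card ≤ 4 * R + 2 ∧ (P.biUnion N).card < P.card := by
  obtain ⟨v, hv⟩ := hW
  by_contra! hcon
  have hgrow : ∀ r ≤ R, (1 + δ) ^ r ≤ (edgeBall N E v r).card := by
    intro r
    induction r with
    | zero => simp [edgeBall]
    | succ r ih =>
      intro hr
      have h1 := ih (by omega)
      have h2 := hexp _ (edgeBall_subset hv hEW r) ⟨v, mem_edgeBall_self N E v r⟩
      have h3 : (E.filter fun e => ¬ Disjoint (N e) (edgeBall N E v r)).card ≤
          (E.filter fun e => N e ⊆ edgeBall N E v (r + 1)).card := by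
        refine card_le_card fun e he => mem_filter.2 ⟨(mem_filter.1 he).1, ?_⟩
        exact (subset_biUnion_of_mem N he).trans subset_union_right
      have h4 : (E.filter fun e => N e ⊆ edgeBall N E v (r + 1)).card ≤
          (edgeBall N E v (r + 1)).card := by
        by_contra! hlt
        obtain ⟨P, hP, hPc, hlt⟩ := exists_card_biUnion_lt_of_edgeBall N E v hN (r + 1) hlt
        exact absurd (hcon P hP (by omega)) (by omega)
      have h5 : ((E.filter fun e => ¬ Disjoint (N e) (edgeBall N E v r)).card : ℝ) ≤
          (edgeBall N E v (r + 1)).card := by exact_mod_cast h3.trans h4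
      rw [pow_succ']
      nlinarith
  have h1 := hgrow R le_rfl
  have h2 : ((edgeBall N E v R).card : ℝ) ≤ W.card := by
    exact_mod_cast card_le_card (edgeBall_subset hv hEW R)
  linarith

/-- A multigraph in which every set of logarithmically many edges spans at least as many vertices
as its size has at most `(1 + δ) |A|` edges. -/
lemma HallUpTo.card_le_of_card_le_two {N : β → Finset α} {E : Finset β} {A : Finset α}
    {δ : ℝ} (hδ : 0 < δ) {R : ℕ} (hR : (A.card : ℝ) < (1 + δ) ^ R)
    (h : HallUpTo N E (4 * R + 2)) (hEA : ∀ e ∈ E, N e ⊆ A)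
    (hN : ∀ e ∈ E, (N e).card ≤ 2) : (E.card : ℝ) ≤ (1 + δ) * A.card := by
  by_contra! hlt
  let 𝒲 := A.powerset.filter fun W =>
    (1 + δ) * W.card < ((E.filter fun e => N e ⊆ W).card : ℝ)
  have hne : 𝒲.Nonempty := by
    refine ⟨A, mem_filter.2 ⟨mem_powerset_self A, ?_⟩⟩
    rwa [filter_true_of_mem hEA]
  obtain ⟨W, hW, hmin⟩ := exists_min_image 𝒲 card hne
  obtain ⟨hWA, hWlt⟩ := mem_filter.1 hW
  rw [mem_powerset] at hWA
  have hWA' : (W.card : ℝ) ≤ A.card := by exact_mod_cast card_le_card hWA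
  have hWne : W.Nonempty := by
    rw [nonempty_iff_ne_empty]
    rintro rfl
    rw [card_empty, Nat.cast_zero, mul_zero, Nat.cast_pos, card_pos] at hWlt
    obtain ⟨e, he⟩ := hWlt
    obtain ⟨heE, he⟩ := mem_filter.1 he
    have := h {e} (singleton_subset_iff.2 heE) (by simp)
    rw [singleton_biUnion, subset_empty.1 he] at this
    simp at this
  obtain ⟨P, hP, hPc, hPlt⟩ := exists_card_biUnion_lt_of_expansion N
    (E.filter fun e => N e ⊆ W) W (fun e he => hN e (mem_filter.1 he).1)
    (fun e he => (mem_filter.1 he).2) hWne hδ (hWA'.trans_lt hR) (by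
      intro U hU hUne
      by_contra! hle
      have hcard : (W \ U).card + U.card = W.card := card_sdiff_add_card_eq_card hU
      have hnot : W \ U ∉ 𝒲 := by
        intro hmem
        have := hmin _ hmem
        have := card_pos.2 hUne
        omega
      have hle' : ((E.filter fun e => N e ⊆ W \ U).card : ℝ) ≤ (1 + δ) * (W \ U).card := by
        by_contra! hlt'
        exact hnot (mem_filter.2 ⟨mem_powerset.2 (sdiff_subset.trans hWA), hlt'⟩)
      have hsplit : (E.filter fun e => N e ⊆ W).card ≤ (E.filter fun e => N e ⊆ W \ U).card +
          ((E.filter fun e => N e ⊆ W).filter fun e => ¬ Disjoint (N e) U).card := by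
        refine le_trans (card_le_card fun e he => ?_) (card_union_le _ _)
        by_cases hd : Disjoint (N e) U
        · refine mem_union_left _ (mem_filter.2 ⟨(mem_filter.1 he).1, ?_⟩)
          exact subset_sdiff.2 ⟨(mem_filter.1 he).2, hd⟩
        · exact mem_union_right _ (mem_filter.2 ⟨he, hd⟩)
      have hsplit' : ((E.filter fun e => N e ⊆ W).card : ℝ) ≤
          (E.filter fun e => N e ⊆ W \ U).card +
          ((E.filter fun e => N e ⊆ W).filter fun e => ¬ Disjoint (N e) U).card := by
        exact_mod_cast hsplit
      have hcard' : ((W \ U).card : ℝ) + U.card = W.card := by exact_mod_cast hcard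
      rw [← hcard'] at hWlt
      linarith)
  have := h P (hP.trans (filter_subset _ _)) hPc
  omega

/-- Removing the sets of size one from a family, together with the points they cover, preserves
Hall's condition at a smaller scale. -/
lemma HallUpTo.remove_singletons {N : β → Finset α} {B : Finset β} {k L : ℕ}
    (hk : ∀ b ∈ B, (N b).card ≤ k) (h : HallUpTo N B ((k + 1) * L)) :
    HallUpTo (fun b => N b \ (B.filter fun b => (N b).card = 1).biUnion N)
      (B.filter fun b => ¬ (N b).card = 1) L := by
  set B₁ := B.filter fun b => (N b).card = 1
  set A₁ := B₁.biUnion N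
  intro P hP hPL
  rcases P.eq_empty_or_nonempty with rfl | ⟨b₀, hb₀⟩
  · simp
  have hne : Nonempty β := ⟨b₀⟩
  have hg : ∀ a ∈ A₁, ∃ b ∈ B₁, N b = {a} := by
    intro a ha
    obtain ⟨b, hb, hab⟩ := mem_biUnion.1 ha
    obtain ⟨x, hx⟩ := card_eq_one.1 (mem_filter.1 hb).2
    refine ⟨b, hb, ?_⟩
    rw [hx, mem_singleton] at hab
    rw [hx, hab]
  choose! g hgB hgN using hg
  set Z := P.biUnion N ∩ A₁
  have hZA : Z ⊆ A₁ := inter_subset_right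
  have hginj : Set.InjOn g Z := by
    intro a ha b hb hab
    have h1 := hgN a (hZA ha)
    rw [hab, hgN b (hZA hb)] at h1
    exact (singleton_injective h1).symm
  have hPB : P ⊆ B := hP.trans (filter_subset _ _)
  have hZcard : Z.card ≤ k * P.card := by
    refine (card_le_card inter_subset_left).trans ?_
    rw [mul_comm]
    exact card_biUnion_le_card_mul P N k fun b hb => hk b (hPB hb)
  have hdisj : Disjoint P (Z.image g) := by
    rw [disjoint_right]
    intro b hb hbP
    obtain ⟨a, ha, rfl⟩ := mem_image.1 hb
    exact (mem_filter.1 (hP hbP)).2 (mem_filter.1 (hgB a (hZA ha))).2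
  have hcard : (P ∪ Z.image g).card = P.card + Z.card := by
    rw [card_union_of_disjoint hdisj, card_image_of_injOn hginj]
  have hmain := h (P ∪ Z.image g) (union_subset hPB (image_subset_iff.2 fun a ha =>
    (mem_filter.1 (hgB a (hZA ha))).1)) (by
      rw [hcard]
      nlinarith)
  have hsub : (P ∪ Z.image g).biUnion N ⊆ (P.biUnion fun b => N b \ A₁) ∪ Z := by
    intro a ha
    obtain ⟨b, hb, hab⟩ := mem_biUnion.1 ha
    rcases mem_union.1 hb with hb | hb
    · by_cases haA : a ∈ A₁
      · exact mem_union_right _ (mem_inter.2 ⟨mem_biUnion.2 ⟨b, hb, hab⟩, haA⟩)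
      · exact mem_union_left _ (mem_biUnion.2 ⟨b, hb, mem_sdiff.2 ⟨hab, haA⟩⟩)
    · obtain ⟨x, hx, rfl⟩ := mem_image.1 hb
      rw [hgN x (hZA hx), mem_singleton] at hab
      exact mem_union_right _ (hab ▸ hx)
  have := (card_le_card hsub).trans (card_union_le _ _)
  omega

lemma HallUpTo.card_filter_card_eq_one_le {N : β → Finset α} {B : Finset β} {L : ℕ}
    (h : HallUpTo N B L) (hL : 2 ≤ L) :
    (B.filter fun b => (N b).card = 1).card ≤
      ((B.filter fun b => (N b).card = 1).biUnion N).card := by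
  set B₁ := B.filter fun b => (N b).card = 1
  have hinj : Set.InjOn N B₁ := by
    intro b hb c hc hbc
    by_contra hne
    have := h {b, c} (insert_subset (mem_filter.1 hb).1
      (singleton_subset_iff.2 (mem_filter.1 hc).1)) (by rw [card_pair hne]; exact hL)
    rw [card_pair hne, biUnion_insert, singleton_biUnion, hbc, union_self,
      (mem_filter.1 hc).2] at this
    omega
  rw [card_biUnion]
  · rw [sum_congr rfl fun b hb => (mem_filter.1 hb).2, sum_const, smul_eq_mul, mul_one]
  · intro b hb c hc hbc
    obtain ⟨x, hx⟩ := card_eq_one.1 (mem_filter.1 hb).2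
    obtain ⟨y, hy⟩ := card_eq_one.1 (mem_filter.1 hc).2
    rw [Function.onFun, hx, hy, disjoint_singleton]
    rintro rfl
    exact hbc (hinj hb hc (hx.trans hy.symm))

/-- The packing bound for a bipartite incidence structure with degrees at most `k` in which no
small subfamily of `B` has fewer neighbours than elements. -/
lemma HallUpTo.three_mul_card_le {k M R : ℕ} {δ : ℝ} (hk : 2 ≤ k) (hδ : 0 < δ)
    (hR : (M : ℝ) < (1 + δ) ^ R) (m : ℕ) :
    ∀ (N : β → Finset α) (A : Finset α) (B : Finset β),
      (∀ b ∈ B, N b ⊆ A) → (∀ b ∈ B, (N b).card ≤ k) →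
      (∀ a ∈ A, (B.filter fun b => a ∈ N b).card ≤ k) →
      HallUpTo N B ((k + 1) ^ m * (4 * R + 2)) → A.card ≤ M → (A.card : ℝ) ≤ m * (δ * M) →
      3 * (B.card : ℝ) ≤ (k + 1) * A.card + 2 * (δ * M) := by
  have hpow : ∀ m : ℕ, 4 * R + 2 ≤ (k + 1) ^ m * (4 * R + 2) := fun m =>
    Nat.le_mul_of_pos_left _ (pow_pos (Nat.succ_pos k) m)
  have hδM : 0 ≤ δ * M := by positivity
  have hnonempty : ∀ (N : β → Finset α) (B : Finset β),
      HallUpTo N B (4 * R + 2) → ∀ b ∈ B, (N b).Nonempty := by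
    intro N B hall b hb
    have := hall {b} (singleton_subset_iff.2 hb) (by simp)
    rw [singleton_biUnion, card_singleton] at this
    exact card_pos.1 this
  induction m with
  | zero =>
    intro N A B hNA _ _ hall _ hAm
    have hA : A = ∅ := by
      rw [Nat.cast_zero, zero_mul] at hAm
      rw [← card_eq_zero]
      exact_mod_cast le_antisymm hAm (Nat.cast_nonneg _)
    have hB : B = ∅ := by
      rw [eq_empty_iff_forall_notMem]
      intro b hb
      have h1 := hnonempty N B (hall.mono subset_rfl (hpow 0)) b hb
      have h2 := hNA b hb
      rw [hA, subset_empty] at h2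
      rw [h2] at h1
      exact not_nonempty_empty h1
    subst hA hB
    simpa using hδM
  | succ m ih =>
    intro N A B hNA hNk hAk hall hAM hAm
    have hall₀ := hall.mono subset_rfl (hpow (m + 1))
    by_cases hsmall : ((B.filter fun b => (N b).card = 1).card : ℝ) ≤ δ * M
    · have h1 : ((B.filter fun b => (N b).card ≤ 2).card : ℝ) ≤ (1 + δ) * A.card :=
        HallUpTo.card_le_of_card_le_two hδ
          (lt_of_le_of_lt (by exact_mod_cast hAM) hR)
          (hall₀.mono (filter_subset _ _) le_rfl) (fun b hb => hNA b (mem_filter.1 hb).1)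
          (fun b hb => (mem_filter.1 hb).2)
      have h2 : 3 * (B.card : ℝ) ≤ k * A.card + (B.filter fun b => (N b).card = 1).card +
          (B.filter fun b => (N b).card ≤ 2).card := by
        exact_mod_cast _root_.three_mul_card_le hNA (hnonempty N B hall₀) hAk
      have h3 : δ * A.card ≤ δ * M := by
        gcongr
      linarith
    · have hstep := HallUpTo.remove_singletons (L := (k + 1) ^ m * (4 * R + 2)) hNk
        (by rwa [← mul_assoc, ← pow_succ'])
      have hB₁ := hall₀.card_filter_card_eq_one_le (by omega)
      have hBsplit := card_filter_add_card_filter_not (s := B) fun b => (N b).card = 1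
      set B₁ := B.filter fun b => (N b).card = 1
      set A₁ := B₁.biUnion N
      have hA₁ : A₁ ⊆ A := biUnion_subset.2 fun b hb => hNA b (mem_filter.1 hb).1
      have hAsplit : ((A \ A₁).card : ℝ) + A₁.card = A.card := by
        exact_mod_cast card_sdiff_add_card_eq_card hA₁
      have hBsplit' : (B₁.card : ℝ) + (B.filter fun b => ¬ (N b).card = 1).card = B.card := by
        exact_mod_cast hBsplit
      have hB₁' : (B₁.card : ℝ) ≤ A₁.card := by exact_mod_cast hB₁
      have hrec := ih (fun b => N b \ A₁) (A \ A₁) (B.filter fun b => ¬ (N b).card = 1)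
        (fun b hb => sdiff_subset_sdiff (hNA b (mem_filter.1 hb).1) subset_rfl)
        (fun b hb => (card_le_card sdiff_subset).trans (hNk b (mem_filter.1 hb).1))
        (fun a ha => (card_le_card fun b hb => mem_filter.2
          ⟨(mem_filter.1 (mem_filter.1 hb).1).1, (mem_sdiff.1 (mem_filter.1 hb).2).1⟩).trans
            (hAk a (mem_sdiff.1 ha).1))
        hstep ((card_le_card sdiff_subset).trans hAM) (by
          push_cast at hAm
          linarith)
      have hk' : (2 : ℝ) ≤ k := by exact_mod_cast hk
      nlinarith [Nat.cast_nonneg (α := ℝ) A₁.card]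

/-- A set meets at most as many members of a packing as it has elements. -/
lemma card_filter_inter_nonempty_le (s : Finset α) (C : Finset (Finset α))
    (hC : ∀ c₁ ∈ C, ∀ c₂ ∈ C, c₁ ≠ c₂ → Disjoint c₁ c₂) :
    (C.filter fun c => (s ∩ c).Nonempty).card ≤ s.card := by
  have h : ∀ c ∈ C.filter fun c => (s ∩ c).Nonempty, ∃ x ∈ s, x ∈ c := by
    intro c hc
    obtain ⟨x, hx⟩ := (mem_filter.1 hc).2
    exact ⟨x, (mem_inter.1 hx).1, (mem_inter.1 hx).2⟩
  rcases isEmpty_or_nonempty α with hα | hα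
  · rw [filter_false_of_mem fun c _ h => hα.elim h.choose, card_empty]
    exact Nat.zero_le _
  choose! x hxs hxc using h
  refine card_le_card_of_injOn x hxs fun c hc d hd hcd => ?_
  by_contra hne
  refine disjoint_left.1 (hC c (mem_filter.1 hc).1 d (mem_filter.1 hd).1 hne) (hxc c hc) ?_
  rw [hcd]
  exact hxc d hd

end


/-- For every integer `k ≥ 3` and every real `ε > 0` there exist `c > 0`
and a threshold `n₀` such that: for any family `S` of `k`-element sets with
`|S| = n ≥ n₀` and any packing `A ⊆ S` admitting no local improvement of size at most
`c · log n` (every packing `P ⊆ S \ A` with `1 ≤ |P| ≤ c · log n` intersects at least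
`|P|` sets of `A`), every packing `B ⊆ S` satisfies `|B| ≤ ((k+1)/3 + ε) · |A|`. -/
theorem stmt_0 (k : ℕ) (hk : 3 ≤ k) (ε : ℝ) (hε : 0 < ε) :
    ∃ c : ℝ, 0 < c ∧ ∃ n₀ : ℕ,
      ∀ (α : Type) [DecidableEq α] (S A : Finset (Finset α)),
        (∀ s ∈ S, s.card = k) →
        n₀ ≤ S.card →
        A ⊆ S →
        (∀ a₁ ∈ A, ∀ a₂ ∈ A, a₁ ≠ a₂ → Disjoint a₁ a₂) →
        (∀ P ⊆ S \ A,
          (∀ p₁ ∈ P, ∀ p₂ ∈ P, p₁ ≠ p₂ → Disjoint p₁ p₂) →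
          1 ≤ P.card → (P.card : ℝ) ≤ c * Real.log S.card →
          P.card ≤ (A.filter (fun a => ∃ p ∈ P, (a ∩ p).Nonempty)).card) →
        ∀ B ⊆ S, (∀ b₁ ∈ B, ∀ b₂ ∈ B, b₁ ≠ b₂ → Disjoint b₁ b₂) →
          (B.card : ℝ) ≤ ((k + 1 : ℝ) / 3 + ε) * A.card := by
  obtain ⟨m, hm⟩ := exists_nat_ge (1 / ε)
  have hlog : 0 < Real.log (1 + ε) := Real.log_pos (by linarith)
  refine ⟨(k + 1) ^ m * (4 / Real.log (1 + ε) + 6), by positivity, 3, ?_⟩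
  intro α _ S A hS hn hAS hA hloc B hBS hB
  have hn' : (3 : ℝ) ≤ S.card := by exact_mod_cast hn
  have hlogn : 1 ≤ Real.log S.card := by
    rw [Real.le_log_iff_exp_le (by linarith)]
    linarith [Real.exp_one_lt_three]
  set R := ⌊Real.log S.card / Real.log (1 + ε)⌋₊ + 1 with hRdef
  have hR : (S.card : ℝ) < (1 + ε) ^ R := by
    rw [← Real.log_lt_log_iff (by linarith) (by positivity), Real.log_pow, ← div_lt_iff₀ hlog]
    rw [hRdef]
    push_cast
    exact Nat.lt_floor_add_one _
  have hRle : (R : ℝ) ≤ Real.log S.card / Real.log (1 + ε) + 1 := by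
    rw [hRdef]
    push_cast
    gcongr
    exact Nat.floor_le (by positivity)
  have hsize : (((k + 1) ^ m * (4 * R + 2) : ℕ) : ℝ) ≤
      (k + 1) ^ m * (4 / Real.log (1 + ε) + 6) * Real.log S.card := by
    push_cast
    rw [mul_assoc]
    gcongr
    have : 4 / Real.log (1 + ε) * Real.log S.card =
      4 * (Real.log S.card / Real.log (1 + ε)) := by ring
    rw [add_mul, this]
    linarith
  have hnonempty : ∀ s ∈ S, s.Nonempty := by
    intro s hs
    rw [← card_pos, hS s hs]
    omega
  set N : Finset α → Finset (Finset α) := fun b => (A \ B).filter fun a => (b ∩ a).Nonempty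
  have hA' : ∀ a₁ ∈ A \ B, ∀ a₂ ∈ A \ B, a₁ ≠ a₂ → Disjoint a₁ a₂ := fun a₁ h₁ a₂ h₂ =>
    hA a₁ (mem_sdiff.1 h₁).1 a₂ (mem_sdiff.1 h₂).1
  have hB' : ∀ b₁ ∈ B \ A, ∀ b₂ ∈ B \ A, b₁ ≠ b₂ → Disjoint b₁ b₂ := fun b₁ h₁ b₂ h₂ =>
    hB b₁ (mem_sdiff.1 h₁).1 b₂ (mem_sdiff.1 h₂).1
  have hall : HallUpTo N (B \ A) ((k + 1) ^ m * (4 * R + 2)) := by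
    intro P hP hPL
    rcases P.eq_empty_or_nonempty with rfl | hPne
    · simp
    refine (hloc P (hP.trans (sdiff_subset_sdiff hBS subset_rfl))
      (fun p₁ h₁ p₂ h₂ => hB' p₁ (hP h₁) p₂ (hP h₂)) (card_pos.2 hPne)
      (le_trans (by exact_mod_cast hPL) hsize)).trans (card_le_card fun a ha => ?_)
    obtain ⟨haA, p, hp, hap⟩ := mem_filter.1 ha
    refine mem_biUnion.2 ⟨p, hp, mem_filter.2 ⟨mem_sdiff.2 ⟨haA, fun haB => ?_⟩, ?_⟩⟩
    · have hpBA := mem_sdiff.1 (hP hp)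
      have hne : a ≠ p := by
        rintro rfl
        exact hpBA.2 haA
      rw [disjoint_iff_inter_eq_empty.1 (hB a haB p hpBA.1 hne)] at hap
      exact not_nonempty_empty hap
    · rwa [inter_comm]
  have hAcard : (A \ B).card ≤ S.card := card_le_card (sdiff_subset.trans hAS)
  have hmain := HallUpTo.three_mul_card_le (M := (A \ B).card) (by omega : 2 ≤ k) hε
    (lt_of_le_of_lt (by exact_mod_cast hAcard) hR) m N (A \ B) (B \ A)
    (fun b _ => filter_subset _ _)
    (fun b hb => (card_filter_inter_nonempty_le b (A \ B) hA').trans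
      (hS b (hBS (mem_sdiff.1 hb).1)).le)
    (fun a ha => by
      refine le_trans (card_le_card fun b hb => ?_)
        ((card_filter_inter_nonempty_le a (B \ A) hB').trans
          (hS a (hAS (mem_sdiff.1 ha).1)).le)
      obtain ⟨hb, hab⟩ := mem_filter.1 hb
      refine mem_filter.2 ⟨hb, ?_⟩
      rw [inter_comm]
      exact (mem_filter.1 hab).2)
    hall le_rfl (by
      rw [div_le_iff₀ hε] at hm
      have : (0 : ℝ) ≤ (A \ B).card := Nat.cast_nonneg _
      nlinarith)
  have hBsplit : ((B \ A).card : ℝ) + (A ∩ B).card = B.card := by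
    rw [inter_comm]
    exact_mod_cast card_sdiff_add_card_inter B A
  have hAsplit : ((A \ B).card : ℝ) + (A ∩ B).card = A.card := by
    exact_mod_cast card_sdiff_add_card_inter A B
  have hk' : (3 : ℝ) ≤ k := by exact_mod_cast hk
  rw [← hBsplit, ← hAsplit]
  have h1 : (0 : ℝ) ≤ (A \ B).card := Nat.cast_nonneg _
  have h2 : (0 : ℝ) ≤ (A ∩ B).card := Nat.cast_nonneg _
  nlinarith [mul_nonneg hε.le h1, mul_nonneg hε.le h2, mul_nonneg (sub_nonneg.2 hk') h2]
end

section
/- For every integer k ≥ 3 and every integer n ≥ 1, there exist two families 𝒜 and ℬ of k-element sets with 𝒜 ∩ ℬ = ∅ such that: |𝒜| = 3n; |ℬ| = (k+1)n; the members of 𝒜 are pairwise disjoint; the members of ℬ are pairwise disjoint; and for every subfamily 𝒯 ⊆ ℬ with |𝒯| ≤ (3e³n/k)^{1/5}, the number of sets a ∈ 𝒜 that intersect at least one member of 𝒯 is at least |𝒯|. -/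
open Finset in
/-- For a uniformly random bijection, the images of the points of `S` all lie in `U` with
probability at most `(|U| / |α|) ^ |S|`. -/
theorem card_equiv_mapsTo_mul_le {α β : Type*} [Fintype α] [Fintype β] [DecidableEq α]
    [DecidableEq β] (U : Finset α) (S : Finset β) :
    #{π : β ≃ α | ∀ x ∈ S, π x ∈ U} * Fintype.card α ^ #S ≤
      #U ^ #S * Fintype.card (β ≃ α) := by
  induction S using Finset.induction_on with
  | empty => simp
  | insert x S hx ih =>
    by_cases hne : IsEmpty (β ≃ α)
    · simp
    obtain ⟨π₀⟩ := not_isEmpty_iff.mp hne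
    have hsym : ∀ y ∈ Sᶜ, #{π : β ≃ α | (∀ z ∈ S, π z ∈ U) ∧ π y ∈ U} =
        #{π : β ≃ α | ∀ z ∈ insert x S, π z ∈ U} := by
      intro y hy
      rw [mem_compl] at hy
      have hfix : ∀ z ∈ S, Equiv.swap x y z = z := fun z hz =>
        Equiv.swap_apply_of_ne_of_ne (by rintro rfl; exact hx hz) (by rintro rfl; exact hy hz)
      refine card_nbij' (fun π => (Equiv.swap x y).trans π) (fun π => (Equiv.swap x y).trans π)
        ?_ ?_ ?_ ?_
      · intro π hπ
        simp only [coe_filter, mem_univ, true_and, Set.mem_ofPred_eq, mem_insert,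
          Equiv.trans_apply] at hπ ⊢
        rintro z (rfl | hz)
        · simpa using hπ.2
        · rw [hfix z hz]; exact hπ.1 z hz
      · intro π hπ
        simp only [coe_filter, mem_univ, true_and, Set.mem_ofPred_eq, mem_insert,
          Equiv.trans_apply] at hπ ⊢
        refine ⟨fun z hz => ?_, ?_⟩
        · rw [hfix z hz]; exact hπ z (Or.inr hz)
        · simpa using hπ x (Or.inl rfl)
      · intro π _; ext z; simp
      · intro π _; ext z; simp
    have hcount : ∀ π ∈ ({π : β ≃ α | ∀ z ∈ S, π z ∈ U} : Finset (β ≃ α)),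
        #{y ∈ Sᶜ | π y ∈ U} = #U - #S := by
      intro π hπ
      simp only [mem_filter, mem_univ, true_and] at hπ
      have hsub : S ⊆ U.map π.symm.toEmbedding := by
        intro z hz
        simpa [mem_map_equiv] using hπ z hz
      rw [← card_map π.symm.toEmbedding (s := U), ← card_sdiff_of_subset hsub]
      congr 1
      ext y
      simp [mem_map_equiv, and_comm]
    have hdouble : #{π : β ≃ α | ∀ z ∈ insert x S, π z ∈ U} * (Fintype.card α - #S) =
        #{π : β ≃ α | ∀ z ∈ S, π z ∈ U} * (#U - #S) := by
      have h := sum_card_bipartiteAbove_eq_sum_card_bipartiteBelow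
        (s := Sᶜ) (t := ({π : β ≃ α | ∀ z ∈ S, π z ∈ U} : Finset (β ≃ α)))
        (fun y π => π y ∈ U)
      simp only [bipartiteAbove, bipartiteBelow, filter_filter] at h
      rw [sum_congr rfl hsym, sum_congr rfl hcount] at h
      simp only [sum_const, smul_eq_mul, card_compl, Fintype.card_congr π₀] at h
      rw [← h, mul_comm]
    have hlt : #S < Fintype.card α := by
      rw [← Fintype.card_congr π₀]
      exact card_lt_univ_of_notMem hx
    have hU : #U ≤ Fintype.card α := card_le_univ U
    have hratio : Fintype.card α * (#U - #S) ≤ #U * (Fintype.card α - #S) := by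
      rw [Nat.mul_sub, Nat.mul_sub, mul_comm (Fintype.card α) #U]
      exact Nat.sub_le_sub_left (Nat.mul_le_mul_right _ hU) _
    have hstep : #{π : β ≃ α | ∀ z ∈ insert x S, π z ∈ U} * Fintype.card α ≤
        #{π : β ≃ α | ∀ z ∈ S, π z ∈ U} * #U := by
      refine Nat.le_of_mul_le_mul_right ?_ (Nat.sub_pos_of_lt hlt)
      calc _ = #{π : β ≃ α | ∀ z ∈ insert x S, π z ∈ U} * (Fintype.card α - #S)
            * Fintype.card α := by ring
        _ = #{π : β ≃ α | ∀ z ∈ S, π z ∈ U} * (Fintype.card α * (#U - #S)) := by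
          rw [hdouble]; ring
        _ ≤ #{π : β ≃ α | ∀ z ∈ S, π z ∈ U} * (#U * (Fintype.card α - #S)) :=
          Nat.mul_le_mul_left _ hratio
        _ = _ := by ring
    rw [card_insert_of_notMem hx]
    calc _ = #{π : β ≃ α | ∀ z ∈ insert x S, π z ∈ U} * Fintype.card α
            * Fintype.card α ^ #S := by ring
      _ ≤ #{π : β ≃ α | ∀ z ∈ S, π z ∈ U} * #U * Fintype.card α ^ #S :=
        Nat.mul_le_mul_right _ hstep
      _ = #{π : β ≃ α | ∀ z ∈ S, π z ∈ U} * Fintype.card α ^ #S * #U := by ring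
      _ ≤ #U ^ #S * Fintype.card (β ≃ α) * #U := Nat.mul_le_mul_right _ ih
      _ = _ := by ring

open Finset in
/-- The points of `W` whose successor is not in `W`; these are the right ends of the arcs of the
cycle `ZMod N` that make up `W`. -/
def arcEnds {N : ℕ} (W : Finset (ZMod N)) : Finset (ZMod N) := {v ∈ W | v + 1 ∉ W}

open Finset in
theorem exists_add_mem_arcEnds {N m : ℕ} [NeZero N] {W : Finset (ZMod N)} (hW : #W ≤ m)
    (hm : m < N) {w : ZMod N} (hw : w ∈ W) :
    ∃ j < m, w + j ∈ arcEnds W ∧ ∀ i ≤ j, w + (i : ℕ) ∈ W := by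
  have hex : ∃ j : ℕ, j ≤ m ∧ w + j ∉ W := by
    by_contra! h
    have hle : #(range (m + 1)) ≤ #W := by
      refine card_le_card_of_injOn (fun j : ℕ => w + (j : ZMod N))
        (fun j hj => h j (by simp at hj; omega)) ?_
      intro i hi j hj hij
      simp only [coe_range, Set.mem_Iio] at hi hj
      have h' : (i : ZMod N) = j := add_left_cancel hij
      rw [ZMod.natCast_eq_natCast_iff'] at h'
      rwa [Nat.mod_eq_of_lt (by omega), Nat.mod_eq_of_lt (by omega)] at h'
    rw [card_range] at hle
    omega
  classical
  obtain ⟨hle, hnot⟩ := Nat.find_spec hex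
  have hmin : ∀ i < Nat.find hex, w + (i : ℕ) ∈ W := by
    intro i hi
    by_contra hc
    exact Nat.find_min hex hi ⟨by omega, hc⟩
  have hpos : Nat.find hex ≠ 0 := by
    intro h0
    rw [h0] at hnot
    simp [hw] at hnot
  obtain ⟨j, hj⟩ := Nat.exists_eq_succ_of_ne_zero hpos
  rw [hj] at hle hnot hmin
  refine ⟨j, hle, ?_, fun i hi => hmin i (by omega)⟩
  simp only [arcEnds, mem_filter]
  refine ⟨hmin j (by omega), ?_⟩
  simpa [add_assoc] using hnot

open Finset in
/-- A set with `c` arcs of length at most `m` is determined by the end points and the lengths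
of its arcs. -/
theorem card_filter_arcEnds_le {N m : ℕ} [NeZero N] (hm : m < N) (c : ℕ) :
    #{W : Finset (ZMod N) | #W ≤ m ∧ #(arcEnds W) = c} ≤ (N * m) ^ c := by
  let decode : (Fin c → ZMod N × Fin m) → Finset (ZMod N) := fun f =>
    univ.biUnion fun i => (range ((f i).2 + 1)).image fun j : ℕ => (f i).1 - (j : ZMod N)
  have hsub : ({W : Finset (ZMod N) | #W ≤ m ∧ #(arcEnds W) = c} : Finset _) ⊆
      univ.image decode := by
    intro W hW
    simp only [mem_filter, mem_univ, true_and] at hW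
    obtain ⟨hWm, hWc⟩ := hW
    let P : ZMod N → ℕ → Prop := fun v l => ∀ j ≤ l, v - (j : ℕ) ∈ W
    classical
    have hlen : ∀ v ∈ arcEnds W, Nat.findGreatest (P v) (m - 1) < m := by
      intro v hv
      have h1 : 0 < #W := card_pos.mpr ⟨v, (mem_filter.mp hv).1⟩
      have h2 := Nat.findGreatest_le (P := P v) (m - 1)
      omega
    let e := (arcEnds W).equivFinOfCardEq hWc
    refine mem_image.mpr ⟨fun i => ((e.symm i).1, ⟨_, hlen _ (e.symm i).2⟩), mem_univ _, ?_⟩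
    ext w
    simp only [decode, mem_biUnion, mem_univ, true_and, mem_image, mem_range]
    constructor
    · rintro ⟨i, j, hj, rfl⟩
      have h0 : P (e.symm i).1 0 := by
        intro j hj
        obtain rfl : j = 0 := by omega
        simpa using (mem_filter.mp (e.symm i).2).1
      exact Nat.findGreatest_spec (P := P (e.symm i).1) (Nat.zero_le (m - 1)) h0 j (by omega)
    · intro hw
      obtain ⟨j, hj, hend, hall⟩ := exists_add_mem_arcEnds hWm hm hw
      refine ⟨e ⟨_, hend⟩, j, ?_, ?_⟩
      · simp only [Equiv.symm_apply_apply]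
        refine Nat.lt_succ_of_le (Nat.le_findGreatest (by omega) ?_)
        intro i hi
        have := hall (j - i) (by omega)
        rw [Nat.cast_sub hi] at this
        convert this using 1
        ring
      · simp
  calc _ ≤ #(univ.image decode) := card_le_card hsub
    _ ≤ #(univ : Finset (Fin c → ZMod N × Fin m)) := card_image_le
    _ = _ := by simp [ZMod.card]

theorem pow_union_bound {n d m c : ℕ} (hn : 1 ≤ n) (h : d * m ^ 4 ≤ 9 * n) :
    m * ((3 * n * m) ^ c * (d * n) ^ (c + 1) * m ^ (3 * (c + 1))) < (3 * n) ^ (3 * (c + 1)) := by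
  calc m * ((3 * n * m) ^ c * (d * n) ^ (c + 1) * m ^ (3 * (c + 1)))
      = (d * m ^ 4) ^ (c + 1) * ((3 * n) ^ c * n ^ (c + 1)) := by
        simp only [mul_pow, ← pow_mul, pow_succ, mul_add]; ring
    _ ≤ (9 * n) ^ (c + 1) * ((3 * n) ^ c * n ^ (c + 1)) :=
        Nat.mul_le_mul_right _ (Nat.pow_le_pow_left h _)
    _ = (3 * n) ^ (3 * c + 2) := by
        have h9 : (9 : ℕ) ^ c = 3 ^ c * 3 ^ c := by rw [← mul_pow]; norm_num
        have h3 : (3 : ℕ) ^ (3 * c) = 3 ^ c * 3 ^ c * 3 ^ c := by ring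
        simp only [mul_pow, pow_succ, h9, h3]; ring
    _ < (3 * n) ^ (3 * (c + 1)) := Nat.pow_lt_pow_right (by omega) (by omega)

open Finset in
/-- There is a regular assignment `π` of the corners of `d * n` triples to the vertices of the
cycle of length `3 * n` such that no vertex set with at most `m` elements contains more triples
than it has arcs. -/
theorem exists_equiv_sparse_triples {n d m : ℕ} [NeZero (3 * n)] (hn : 1 ≤ n) (hd : 1 ≤ d)
    (hm : m < 3 * n) (h : d * m ^ 4 ≤ 9 * n) :
    ∃ π : Fin (d * n) × Fin 3 ≃ ZMod (3 * n) × Fin d,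
      ∀ W : Finset (ZMod (3 * n)), #W ≤ m → W.Nonempty →
        ∀ J : Finset (Fin (d * n)), #J = #(arcEnds W) + 1 → ∃ j ∈ J, ∃ r, (π (j, r)).1 ∉ W := by
  classical
  by_contra! hbad
  set E := Fintype.card (Fin (d * n) × Fin 3 ≃ ZMod (3 * n) × Fin d) with hE
  have hEpos : 0 < E := by
    have : Nonempty (Fin (d * n) × Fin 3 ≃ ZMod (3 * n) × Fin d) :=
      ⟨Fintype.equivOfCardEq (by simp [ZMod.card]; ring)⟩
    exact Fintype.card_pos
  let bad : Finset (ZMod (3 * n)) × Finset (Fin (d * n)) →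
      Finset (Fin (d * n) × Fin 3 ≃ ZMod (3 * n) × Fin d) := fun p =>
    {π | ∀ x ∈ p.2 ×ˢ (univ : Finset (Fin 3)), π x ∈ p.1 ×ˢ (univ : Finset (Fin d))}
  let pairs : ℕ → Finset (Finset (ZMod (3 * n)) × Finset (Fin (d * n))) := fun c =>
    ({W | #W ≤ m ∧ #(arcEnds W) = c} : Finset _) ×ˢ powersetCard (c + 1) univ
  have hcover : (univ : Finset (Fin (d * n) × Fin 3 ≃ ZMod (3 * n) × Fin d)) ⊆
      (Icc 1 m).biUnion fun c => (pairs c).biUnion bad := by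
    intro π _
    obtain ⟨W, hWm, ⟨w, hw⟩, J, hJ, hall⟩ := hbad π
    obtain ⟨j, -, hj, -⟩ := exists_add_mem_arcEnds hWm hm hw
    have h1 : 0 < #(arcEnds W) := card_pos.mpr ⟨_, hj⟩
    have h2 : #(arcEnds W) ≤ #W := card_filter_le _ _
    simp only [mem_biUnion]
    refine ⟨#(arcEnds W), mem_Icc.mpr ⟨h1, h2.trans hWm⟩, (W, J), ?_, ?_⟩
    · simp [pairs, hWm, hJ]
    · simp only [bad, mem_filter, mem_univ, true_and, mem_product, and_true]
      exact fun x hx => hall x.1 hx x.2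
  have hbadcard : ∀ c, ∀ p ∈ pairs c,
      #(bad p) * (3 * n) ^ (3 * (c + 1)) ≤ m ^ (3 * (c + 1)) * E := by
    rintro c ⟨W, J⟩ hp
    simp only [pairs, mem_product, mem_filter, mem_univ, true_and, mem_powersetCard,
      subset_univ] at hp
    have key := card_equiv_mapsTo_mul_le (W ×ˢ (univ : Finset (Fin d)))
      (J ×ˢ (univ : Finset (Fin 3)))
    simp only [card_product, card_univ, Fintype.card_fin, Fintype.card_prod, ZMod.card, hp.2,
      mul_comm (c + 1) 3] at key
    rw [mul_pow (3 * n) d, mul_pow #W d] at key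
    refine Nat.le_of_mul_le_mul_right ?_ (pow_pos hd (3 * (c + 1)))
    calc _ = #(bad (W, J)) * ((3 * n) ^ (3 * (c + 1)) * d ^ (3 * (c + 1))) := by ring
      _ ≤ #W ^ (3 * (c + 1)) * d ^ (3 * (c + 1)) * E := key
      _ ≤ m ^ (3 * (c + 1)) * d ^ (3 * (c + 1)) * E := by
        gcongr
        exact hp.1.1
      _ = _ := by ring
  have hterm : ∀ c, m * #((pairs c).biUnion bad) < E := by
    intro c
    have hpairs : #(pairs c) ≤ (3 * n * m) ^ c * (d * n) ^ (c + 1) := by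
      rw [card_product, card_powersetCard, card_univ, Fintype.card_fin]
      exact Nat.mul_le_mul (card_filter_arcEnds_le hm c) (Nat.choose_le_pow _ _)
    have hpos : 0 < (3 * n) ^ (3 * (c + 1)) := by positivity
    refine Nat.lt_of_mul_lt_mul_right (a := (3 * n) ^ (3 * (c + 1))) ?_
    calc m * #((pairs c).biUnion bad) * (3 * n) ^ (3 * (c + 1))
        ≤ m * (∑ p ∈ pairs c, #(bad p)) * (3 * n) ^ (3 * (c + 1)) := by
          gcongr
          exact card_biUnion_le
      _ = m * ∑ p ∈ pairs c, #(bad p) * (3 * n) ^ (3 * (c + 1)) := by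
          rw [mul_assoc, sum_mul]
      _ ≤ m * ∑ _p ∈ pairs c, m ^ (3 * (c + 1)) * E :=
          Nat.mul_le_mul_left _ (sum_le_sum (hbadcard c))
      _ = m * (#(pairs c) * m ^ (3 * (c + 1))) * E := by
          rw [sum_const, smul_eq_mul]; ring
      _ ≤ m * ((3 * n * m) ^ c * (d * n) ^ (c + 1) * m ^ (3 * (c + 1))) * E := by
          gcongr
      _ < (3 * n) ^ (3 * (c + 1)) * E := Nat.mul_lt_mul_of_pos_right (pow_union_bound hn h) hEpos
      _ = _ := mul_comm _ _
  have hsum : E ≤ ∑ c ∈ Icc 1 m, #((pairs c).biUnion bad) := by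
    rw [hE, ← card_univ]
    exact (card_le_card hcover).trans card_biUnion_le
  have hm1 : (Icc 1 m).Nonempty := by
    by_contra hemp
    rw [not_nonempty_iff_eq_empty] at hemp
    rw [hemp, sum_empty] at hsum
    omega
  have hlt : ∑ c ∈ Icc 1 m, m * #((pairs c).biUnion bad) < ∑ _c ∈ Icc 1 m, E :=
    sum_lt_sum_of_nonempty hm1 fun c _ => hterm c
  rw [← mul_sum, sum_const, smul_eq_mul, Nat.card_Icc, Nat.add_sub_cancel] at hlt
  exact absurd (Nat.mul_le_mul_left m hsum) (not_le.mpr hlt)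

open Finset in
/-- Distribute the points `V × ι` of a packing indexed by `V` among sets indexed by `β`
according to `o`, and fill the latter up with new points to cardinality `|ι|`. -/
theorem exists_packings_of_owner {V β ι : Type*} [Fintype V] [Fintype β] [Fintype ι]
    [DecidableEq β] (o : V × ι → β)
    (hfib : ∀ b, #{x | o x = b} ≤ Fintype.card ι)
    (hne : ∀ v, ∃ i j, o (v, i) ≠ o (v, j)) :
    ∃ (f : V → Finset ℕ) (g : β → Finset ℕ),
      (∀ v, #(f v) = Fintype.card ι) ∧ (∀ b, #(g b) = Fintype.card ι) ∧
      (∀ v w, v ≠ w → Disjoint (f v) (f w)) ∧ (∀ b c, b ≠ c → Disjoint (g b) (g c)) ∧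
      (∀ v b, f v ≠ g b) ∧ (∀ v b, (f v ∩ g b).Nonempty ↔ ∃ i, o (v, i) = b) := by
  classical
  obtain ⟨φ, hφ⟩ : ∃ φ : (V × ι) ⊕ (β × ℕ) → ℕ, Function.Injective φ := by
    have := Finite.to_countable (α := V × ι)
    have := Finite.to_countable (α := β)
    exact Countable.exists_injective_nat _
  let e : (V × ι) ⊕ (β × ℕ) ↪ ℕ := ⟨φ, hφ⟩
  let f : V → Finset ((V × ι) ⊕ (β × ℕ)) := fun v =>
    (({v} : Finset V) ×ˢ (univ : Finset ι)).disjSum ∅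
  let g : β → Finset ((V × ι) ⊕ (β × ℕ)) := fun b =>
    ({x | o x = b} : Finset (V × ι)).disjSum
      (({b} : Finset β) ×ˢ range (Fintype.card ι - #{x | o x = b}))
  have hf : ∀ v x, x ∈ f v ↔ ∃ i, x = Sum.inl (v, i) := by
    rintro v (⟨w, i⟩ | ⟨b, j⟩)
    · simp [f, eq_comm]
    · simp [f]
  have hg : ∀ b x i, Sum.inl (x, i) ∈ g b ↔ o (x, i) = b := by
    intro b x i
    simp [g]
  refine ⟨fun v => (f v).map e, fun b => (g b).map e, ?_, ?_, ?_, ?_, ?_, ?_⟩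
  · intro v
    simp [f]
  · intro b
    have := hfib b
    simp only [g, card_map, card_disjSum, card_product, card_singleton, card_range, one_mul]
    omega
  · intro v w hvw
    rw [disjoint_map, disjoint_left]
    intro x hx hx'
    obtain ⟨i, rfl⟩ := (hf _ _).mp hx
    obtain ⟨j, hj⟩ := (hf _ _).mp hx'
    simp only [Sum.inl.injEq, Prod.mk.injEq] at hj
    exact hvw hj.1
  · intro b c hbc
    rw [disjoint_map, disjoint_left]
    rintro (⟨x, i⟩ | ⟨b', j⟩) hx hx'
    · rw [hg] at hx hx'
      exact hbc (hx.symm.trans hx')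
    · simp only [g, inr_mem_disjSum, mem_product, mem_singleton] at hx hx'
      exact hbc (hx.1.symm.trans hx'.1)
  · intro v b heq
    have heq' : f v = g b := map_injective e heq
    obtain ⟨i, j, hij⟩ := hne v
    have hall : ∀ l, o (v, l) = b := fun l => by
      rw [← hg, ← heq', hf]
      exact ⟨l, rfl⟩
    exact hij ((hall i).trans (hall j).symm)
  · intro v b
    rw [← map_inter, map_nonempty]
    constructor
    · rintro ⟨x, hx⟩
      rw [mem_inter] at hx
      obtain ⟨i, rfl⟩ := (hf _ _).mp hx.1
      exact ⟨i, (hg _ _ _).mp hx.2⟩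
    · rintro ⟨i, hi⟩
      exact ⟨Sum.inl (v, i), mem_inter.mpr ⟨(hf _ _).mpr ⟨i, rfl⟩, (hg _ _ _).mpr hi⟩⟩

/-- The member of the second packing that owns a point of the vertex `v`: the two edges of the
cycle at `v` own one point each, and the triples own the other points as prescribed by `π`. -/
def slotOwner {N d : ℕ} {J : Type*} (π : J × Fin 3 ≃ ZMod N × Fin d) :
    ZMod N × (Fin d ⊕ Bool) → ZMod N ⊕ J
  | (v, Sum.inl i) => Sum.inr (π.symm (v, i)).1
  | (v, Sum.inr false) => Sum.inl v
  | (v, Sum.inr true) => Sum.inl (v - 1)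

open Finset in
theorem card_slotOwner_fiber_le {N d : ℕ} [NeZero N] {J : Type*} [DecidableEq J]
    (π : J × Fin 3 ≃ ZMod N × Fin d) (hd : 1 ≤ d) (b : ZMod N ⊕ J) :
    #{x | slotOwner π x = b} ≤ d + 2 := by
  rcases b with v | j
  · have hsub : ({x | slotOwner π x = Sum.inl v} : Finset (ZMod N × (Fin d ⊕ Bool))) ⊆
        {(v, Sum.inr false), (v + 1, Sum.inr true)} := by
      rintro ⟨w, i | _ | _⟩ hx <;> replace hx := (mem_filter.mp hx).2
      · simp [slotOwner] at hx
      · simpa [slotOwner] using hx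
      · simp only [slotOwner, Sum.inl.injEq] at hx
        simp [← hx]
    exact (card_le_card hsub).trans (card_le_two.trans (by omega))
  · have hsub : ({x | slotOwner π x = Sum.inr j} : Finset (ZMod N × (Fin d ⊕ Bool))) ⊆
        univ.image fun r : Fin 3 => ((π (j, r)).1, Sum.inl (π (j, r)).2) := by
      rintro ⟨w, i | _ | _⟩ hx <;> replace hx := (mem_filter.mp hx).2
      · simp only [slotOwner, Sum.inr.injEq] at hx
        refine mem_image.mpr ⟨(π.symm (w, i)).2, mem_univ _, ?_⟩
        simp [← hx]
      · simp [slotOwner] at hx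
      · simp [slotOwner] at hx
    refine (card_le_card hsub).trans (card_image_le.trans ?_)
    simp only [card_univ, Fintype.card_fin]
    omega

open Finset in
/-- If no set of at most `m` vertices contains more triples than it has arcs, then every
collection of at most `m + 1` edges and triples meets at least as many vertices. -/
theorem card_le_card_neighbors {N d m : ℕ} [NeZero N] {J : Type*} [Fintype J] [DecidableEq J]
    (π : J × Fin 3 ≃ ZMod N × Fin d)
    (hπ : ∀ W : Finset (ZMod N), #W ≤ m → W.Nonempty →
      ∀ S : Finset J, #S = #(arcEnds W) + 1 → ∃ j ∈ S, ∃ r, (π (j, r)).1 ∉ W)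
    (T : Finset (ZMod N ⊕ J)) (hT : #T ≤ m + 1) :
    #T ≤ #{v : ZMod N | ∃ i, slotOwner π (v, i) ∈ T} := by
  by_contra! hlt
  set W : Finset (ZMod N) := {v | ∃ i, slotOwner π (v, i) ∈ T} with hW
  have htriple : ∀ j, Sum.inr j ∈ T → ∀ r, (π (j, r)).1 ∈ W := by
    intro j hj r
    simp only [hW, mem_filter, mem_univ, true_and]
    exact ⟨Sum.inl (π (j, r)).2, by simpa [slotOwner] using hj⟩
  have hedge : ∀ v, Sum.inl v ∈ T → v ∈ W ∧ v + 1 ∈ W := by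
    intro v hv
    simp only [hW, mem_filter, mem_univ, true_and]
    exact ⟨⟨Sum.inr false, hv⟩, ⟨Sum.inr true, by simpa [slotOwner] using hv⟩⟩
  have hne : W.Nonempty := by
    obtain ⟨v | j, hx⟩ : T.Nonempty := card_pos.mp (by omega)
    · exact ⟨v, (hedge v hx).1⟩
    · exact ⟨_, htriple j hx 0⟩
  have hleft : #T.toLeft + #(arcEnds W) ≤ #W := by
    rw [← card_union_of_disjoint]
    · refine card_le_card (union_subset (fun v hv => (hedge v (mem_toLeft.mp hv)).1) ?_)
      exact filter_subset _ _
    · rw [disjoint_left]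
      intro v hv hv'
      exact (mem_filter.mp hv').2 (hedge v (mem_toLeft.mp hv)).2
  have hsplit : #T.toLeft + #T.toRight = #T := card_toLeft_add_card_toRight
  obtain ⟨S, hS, hScard⟩ := exists_subset_card_eq (s := T.toRight)
    (n := #(arcEnds W) + 1) (by omega)
  obtain ⟨j, hj, r, hr⟩ := hπ W (by omega) hne S hScard
  exact hr (htriple j (mem_toRight.mp (hS hj)) r)

theorem mul_pow_five_le_of_le_rpow {k n t : ℕ} (hk : 0 < k)
    (ht : (t : ℝ) ≤ (3 * Real.exp 3 * n / k) ^ ((1 : ℝ) / 5)) : k * t ^ 5 ≤ 61 * n := by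
  have hx : 0 ≤ 3 * Real.exp 3 * n / k := by positivity
  have h5 : (t : ℝ) ^ 5 ≤ 3 * Real.exp 3 * n / k := by
    calc (t : ℝ) ^ 5 ≤ ((3 * Real.exp 3 * n / k) ^ ((1 : ℝ) / 5)) ^ 5 := by gcongr
      _ = 3 * Real.exp 3 * n / k := by
        rw [← Real.rpow_natCast, ← Real.rpow_mul hx]
        norm_num
  have he : 3 * Real.exp 3 ≤ 61 := by
    have h1 : Real.exp 3 = Real.exp 1 ^ 3 := by
      rw [← Real.exp_nat_mul]
      norm_num
    have h2 : Real.exp 1 ^ 3 ≤ 2.719 ^ 3 := by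
      have := Real.exp_one_lt_d9
      gcongr
      linarith
    rw [h1]
    norm_num at h2 ⊢
    linarith
  have hk' : (0 : ℝ) < k := by exact_mod_cast hk
  rw [le_div_iff₀ hk'] at h5
  have : (k : ℝ) * (t : ℝ) ^ 5 ≤ 61 * n := by
    have hn : (0 : ℝ) ≤ n := Nat.cast_nonneg n
    nlinarith
  exact_mod_cast this

theorem mul_pow_four_le {k n m : ℕ} (h : k * (m + 1) ^ 5 ≤ 61 * n) : k * m ^ 4 ≤ 9 * n := by
  have hm : 61 * m ^ 4 ≤ 9 * (m + 1) ^ 5 := by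
    rcases le_or_gt m 3 with h3 | h3
    · interval_cases m <;> norm_num
    · obtain ⟨a, rfl⟩ := Nat.exists_eq_add_of_lt h3
      ring_nf
      nlinarith [Nat.zero_le a, Nat.zero_le (a ^ 2), Nat.zero_le (a ^ 3), Nat.zero_le (a ^ 4),
        Nat.zero_le (a ^ 5)]
  nlinarith [Nat.mul_le_mul_left k hm]

/-- For every integer `k ≥ 3` and every `n ≥ 1` there exist disjoint
families `A`, `B` of `k`-element sets, `A` and `B` each a packing, with `|A| = 3n`,
`|B| = (k+1)n`, and such that every subfamily `T ⊆ B` with `|T| ≤ (3e³n/k)^(1/5)`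
intersects at least `|T|` sets of `A`. -/
theorem stmt_1 (k n : ℕ) (hk : 3 ≤ k) (hn : 1 ≤ n) :
    ∃ A B : Finset (Finset ℕ),
      Disjoint A B ∧
      A.card = 3 * n ∧
      B.card = (k + 1) * n ∧
      (∀ s ∈ A, s.card = k) ∧
      (∀ s ∈ B, s.card = k) ∧
      (∀ a₁ ∈ A, ∀ a₂ ∈ A, a₁ ≠ a₂ → Disjoint a₁ a₂) ∧
      (∀ b₁ ∈ B, ∀ b₂ ∈ B, b₁ ≠ b₂ → Disjoint b₁ b₂) ∧
      (∀ T ⊆ B, (T.card : ℝ) ≤ (3 * Real.exp 3 * n / k) ^ ((1 : ℝ) / 5) →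
        T.card ≤ (A.filter (fun a => ∃ t ∈ T, (a ∩ t).Nonempty)).card) := by
  classical
  obtain ⟨d, rfl⟩ : ∃ d, k = d + 2 := ⟨k - 2, by omega⟩
  have hd : 1 ≤ d := by omega
  have : NeZero (3 * n) := ⟨by omega⟩
  set t₀ : ℝ := (3 * Real.exp 3 * n / (d + 2 : ℕ)) ^ ((1 : ℝ) / 5) with ht₀
  have ht₀' : 0 ≤ t₀ := by positivity
  obtain ⟨m, hmt, hm4⟩ : ∃ m, ⌊t₀⌋₊ ≤ m + 1 ∧ (d + 2) * m ^ 4 ≤ 9 * n := by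
    rcases Nat.eq_zero_or_pos ⌊t₀⌋₊ with h0 | hpos
    · exact ⟨0, by omega, by simp⟩
    · refine ⟨⌊t₀⌋₊ - 1, by omega, mul_pow_four_le ?_⟩
      rw [Nat.sub_add_cancel hpos]
      exact mul_pow_five_le_of_le_rpow (by omega) (Nat.floor_le ht₀')
  have hm : m < 3 * n := by
    by_contra! hge
    have h1 : m ≤ m ^ 4 := Nat.le_self_pow (by norm_num) m
    have h2 : m ^ 4 = m ^ 3 * m := by ring
    have h3 : 3 ^ 3 ≤ m ^ 3 := Nat.pow_le_pow_left (by omega) 3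
    nlinarith
  obtain ⟨π, hπ⟩ := exists_equiv_sparse_triples hn hd hm
    ((Nat.mul_le_mul_right _ (Nat.le_add_right d 2)).trans hm4)
  obtain ⟨f, g, hf, hg, hfd, hgd, hfg, hinc⟩ := exists_packings_of_owner (slotOwner π)
    (fun b => by simpa using card_slotOwner_fiber_le π hd b)
    (fun v => ⟨Sum.inl ⟨0, hd⟩, Sum.inr false, by simp [slotOwner]⟩)
  simp only [Fintype.card_sum, Fintype.card_fin, Fintype.card_bool] at hf hg
  have inj : ∀ {α : Type} (h : α → Finset ℕ), (∀ a, (h a).card = d + 2) →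
      (∀ a b, a ≠ b → Disjoint (h a) (h b)) → Function.Injective h := by
    intro α h hcard hdisj a b hab
    by_contra hne
    have h0 := hdisj a b hne
    rw [hab, disjoint_self, Finset.bot_eq_empty] at h0
    have := hcard b
    simp [h0] at this
  have hfi := inj f hf hfd
  have hgi := inj g hg hgd
  refine ⟨Finset.univ.image f, Finset.univ.image g, ?_, ?_, ?_, ?_, ?_, ?_, ?_, ?_⟩
  · rw [Finset.disjoint_left]
    simp only [Finset.mem_image, Finset.mem_univ, true_and, not_exists]
    rintro _ ⟨v, rfl⟩ b hb
    exact hfg v b hb.symm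
  · rw [Finset.card_image_of_injective _ hfi, Finset.card_univ, ZMod.card]
  · rw [Finset.card_image_of_injective _ hgi, Finset.card_univ, Fintype.card_sum, ZMod.card,
      Fintype.card_fin]
    ring
  · simpa using hf
  · simp only [Finset.mem_image, Finset.mem_univ, true_and]
    rintro _ ⟨b, rfl⟩
    exact hg b
  · simp only [Finset.mem_image, Finset.mem_univ, true_and]
    rintro _ ⟨v, rfl⟩ _ ⟨w, rfl⟩ hvw
    exact hfd v w fun h => hvw (h ▸ rfl)
  · simp only [Finset.mem_image, Finset.mem_univ, true_and]
    rintro _ ⟨v, rfl⟩ _ ⟨w, rfl⟩ hvw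
    exact hgd v w fun h => hvw (h ▸ rfl)
  · intro T hTB hT
    obtain ⟨T', -, rfl⟩ := Finset.subset_image_iff.mp hTB
    rw [Finset.card_image_of_injective _ hgi] at hT ⊢
    refine (card_le_card_neighbors π hπ T' ((Nat.le_floor hT).trans hmt)).trans ?_
    rw [← Finset.card_image_of_injective _ hfi]
    refine Finset.card_le_card fun s hs => ?_
    simp only [Finset.mem_image, Finset.mem_filter, Finset.mem_univ, true_and] at hs ⊢
    obtain ⟨v, ⟨i, hi⟩, rfl⟩ := hs
    exact ⟨⟨v, rfl⟩, _, ⟨_, hi, rfl⟩, (hinc _ _).mpr ⟨i, rfl⟩⟩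
end

section
/- There is a constant c > 0 such that for every integer k ≥ 3, every real ε ∈ (0,1), and all finite packings 𝒜, ℬ of k-element sets with 𝒜 ∩ ℬ = ∅ satisfying: for every subfamily V ⊆ ℬ with |V| ≤ c·k/ε, the number of sets in 𝒜 intersecting at least one member of V is at least |V| — the following holds. There exist a subset S ⊆ B₁¹ with |B₁¹ \ S| ≤ ε·|ℬ| and an injective map f from S into the set of surplus slots such that for every b ∈ ℬ with deg(b) ≥ 3, the number of s ∈ S for which f(s) is a surplus edge of the form (a, b) is at most deg(b) − 2 (i.e., after excluding the matched surplus edges, every vertex of ℬ retains degree at least 2). -/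
/-- A family of pairwise disjoint vertex sets with pairwise disjoint neighbourhoods, each of which
is tight (`#N(V) = #V`), has size at most `m` and spans at least `2 * #V - 1` edges. -/
structure IsTightFamily {α β : Type*} [DecidableEq α] (N : β → Finset α) (m : ℕ)
    (P : Finset (Finset β)) : Prop where
  disjoint : (P : Set (Finset β)).PairwiseDisjoint id
  disjoint_nbhd : (P : Set (Finset β)).PairwiseDisjoint (fun V => V.biUnion N)
  tight : ∀ V ∈ P, (V.biUnion N).card = V.card
  card_le : ∀ V ∈ P, V.card ≤ m
  edges : ∀ V ∈ P, 2 * V.card ≤ ∑ b ∈ V, (N b).card + 1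

open Finset in
/-- If a vertex `b` outside the tight family has at most one neighbour not covered by the small
members, then the family can be enlarged by merging `b` with the small members it meets. -/
theorem IsTightFamily.exists_merge {α β : Type*} [DecidableEq α] [DecidableEq β]
    {N : β → Finset α} {B : Finset β} {k s : ℕ} (hs : 1 ≤ s)
    (hN : ∀ b ∈ B, (N b).card ≤ k)
    (hloc : ∀ V ⊆ B, V.card ≤ 2 * (k * (s - 1) + 1) → V.card ≤ (V.biUnion N).card)
    {P : Finset (Finset β)} (hP : IsTightFamily N (k * (s - 1) + 1) P)
    (hPB : P.biUnion id ⊆ B) {b : β} (hb : b ∈ B) (hbP : b ∉ P.biUnion id)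
    (hfew : (N b \ (P.filter (fun V => V.card < s)).biUnion (fun V => V.biUnion N)).card < 2) :
    ∃ Q : Finset (Finset β), IsTightFamily N (k * (s - 1) + 1) Q ∧
      Q.biUnion id = insert b (P.biUnion id) := by
  classical
  set As := (P.filter (fun V => V.card < s)).biUnion (fun V => V.biUnion N) with hAs
  set J := P.filter (fun V => V.card < s ∧ (V.biUnion N ∩ N b).Nonempty) with hJ
  have hJP : J ⊆ P := filter_subset _ _
  have hJs : ∀ V ∈ J, V.card ≤ s - 1 := fun V hV => by
    have := (mem_filter.1 hV).2.1
    omega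
  have hVB : ∀ V ∈ P, V ⊆ B := fun V hV => (subset_biUnion_of_mem id hV).trans hPB
  have hbV : ∀ V ∈ P, b ∉ V := fun V hV h => hbP (mem_biUnion.2 ⟨V, hV, h⟩)
  set W := J.biUnion id with hW
  have hbW : b ∉ W := fun h => hbP (biUnion_subset_biUnion_of_subset_left _ hJP h)
  have hWB : W ⊆ B := (biUnion_subset_biUnion_of_subset_left _ hJP).trans hPB
  have hWN : W.biUnion N = J.biUnion (fun V => V.biUnion N) := by
    ext a; simp only [hW, mem_biUnion, id]; tauto
  have hdisJ : (J : Set (Finset β)).PairwiseDisjoint id := hP.disjoint.subset (by exact_mod_cast hJP)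
  have hdisJN : (J : Set (Finset β)).PairwiseDisjoint (fun V => V.biUnion N) :=
    hP.disjoint_nbhd.subset (by exact_mod_cast hJP)
  have hWcard : W.card = ∑ V ∈ J, V.card := card_biUnion hdisJ
  have hWNcard : (W.biUnion N).card = W.card := by
    rw [hWN, hWcard, card_biUnion hdisJN]
    exact sum_congr rfl fun V hV => hP.tight V (hJP hV)
  -- the covered neighbours of `b` are the ones in `N(W)`
  have hcov : N b ∩ As = N b ∩ W.biUnion N := by
    ext a
    simp only [hWN, hAs, hJ, mem_inter, mem_biUnion, mem_filter]
    constructor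
    · rintro ⟨ha, V, ⟨hV, hVs⟩, x, hx, hax⟩
      exact ⟨ha, V, ⟨hV, hVs, a, mem_inter.2 ⟨mem_biUnion.2 ⟨x, hx, hax⟩, ha⟩⟩, x, hx, hax⟩
    · rintro ⟨ha, V, ⟨hV, hVs, -⟩, x, hx, hax⟩
      exact ⟨ha, V, ⟨hV, hVs⟩, x, hx, hax⟩
  have hsd : N b \ As = N b \ W.biUnion N := by
    rw [← sdiff_inter_self_left, hcov, sdiff_inter_self_left]
  have hJcard : J.card ≤ (N b ∩ W.biUnion N).card := by
    have h1 : (N b ∩ W.biUnion N).card = ∑ V ∈ J, (V.biUnion N ∩ N b).card := by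
      rw [hWN, inter_comm, biUnion_inter, card_biUnion]
      intro V hV V' hV' hne
      exact (hdisJN hV hV' hne).mono inter_subset_left inter_subset_left
    rw [h1, card_eq_sum_ones]
    exact sum_le_sum fun V hV => (mem_filter.1 hV).2.2.card_pos
  have hsplit := card_inter_add_card_sdiff (N b) (W.biUnion N)
  rw [hsd] at hfew
  have hWs : W.card ≤ k * (s - 1) := by
    rw [hWcard]
    calc _ ≤ ∑ V ∈ J, (s - 1) := sum_le_sum hJs
      _ = J.card * (s - 1) := by simp
      _ ≤ _ := Nat.mul_le_mul_right _ (by have := hN b hb; omega)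
  set V₀ := insert b W with hV₀
  have hV₀card : V₀.card = W.card + 1 := card_insert_of_notMem hbW
  have hV₀B : V₀ ⊆ B := insert_subset hb hWB
  have hV₀N : V₀.biUnion N = N b \ W.biUnion N ∪ W.biUnion N := by
    rw [hV₀, biUnion_insert, sdiff_union_self_eq_union]
  have hV₀Ncard : (V₀.biUnion N).card = (N b \ W.biUnion N).card + W.card := by
    rw [hV₀N, card_union_of_disjoint sdiff_disjoint, hWNcard]
  have hone : (N b \ W.biUnion N).card = 1 := by
    have := hloc V₀ hV₀B (by omega)
    omega
  -- the uncovered neighbour of `b` lies outside all members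
  have hout : ∀ V ∈ P, V ∉ J → Disjoint (V.biUnion N) (V₀.biUnion N) := by
    intro V hV hVJ
    have hVW : Disjoint (V.biUnion N) (W.biUnion N) := by
      rw [hWN, disjoint_biUnion_right]
      exact fun V' hV' => hP.disjoint_nbhd hV (hJP hV') (fun h => hVJ (h ▸ hV'))
    rw [hV₀N, disjoint_union_right]
    refine ⟨?_, hVW⟩
    by_contra hnd
    have hsub : N b \ W.biUnion N ⊆ V.biUnion N := by
      obtain ⟨x, hx⟩ := card_eq_one.1 hone
      rw [hx] at hnd ⊢
      simpa using hnd
    have hVW' : Disjoint V V₀ := by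
      rw [hV₀, disjoint_insert_right, hW, disjoint_biUnion_right]
      exact ⟨hbV V hV, fun V' hV' => hP.disjoint hV (hJP hV') (fun h => hVJ (h ▸ hV'))⟩
    have hc := hloc (V ∪ V₀) (union_subset (hVB V hV) hV₀B) (by
      have := hP.card_le V hV
      have := card_union_le V V₀
      omega)
    rw [card_union_of_disjoint hVW', union_biUnion, hV₀N, ← union_assoc,
      union_eq_left.2 hsub, card_union_of_disjoint hVW, hWNcard, hP.tight V hV] at hc
    omega
  refine ⟨insert V₀ (P \ J), ⟨?_, ?_, ?_, ?_, ?_⟩, ?_⟩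
  · rw [coe_insert, Set.pairwiseDisjoint_insert]
    refine ⟨hP.disjoint.subset (by simp), fun V hV _ => ?_⟩
    obtain ⟨hV, hVJ⟩ := mem_sdiff.1 (mem_coe.1 hV)
    simp only [id, hV₀, disjoint_insert_left, hW, disjoint_biUnion_left]
    exact ⟨hbV V hV, fun V' hV' => hP.disjoint (hJP hV') hV (fun h => hVJ (h ▸ hV'))⟩
  · rw [coe_insert, Set.pairwiseDisjoint_insert]
    refine ⟨hP.disjoint_nbhd.subset (by simp), fun V hV _ => ?_⟩
    obtain ⟨hV, hVJ⟩ := mem_sdiff.1 (mem_coe.1 hV)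
    exact (hout V hV hVJ).symm
  · simp only [mem_insert, mem_sdiff, forall_eq_or_imp]
    exact ⟨by omega, fun V hV => hP.tight V hV.1⟩
  · simp only [mem_insert, mem_sdiff, forall_eq_or_imp]
    exact ⟨by omega, fun V hV => hP.card_le V hV.1⟩
  · simp only [mem_insert, mem_sdiff, forall_eq_or_imp]
    refine ⟨?_, fun V hV => hP.edges V hV.1⟩
    have h1 : ∑ x ∈ V₀, (N x).card = (N b).card + ∑ V ∈ J, ∑ x ∈ V, (N x).card := by
      rw [hV₀, sum_insert hbW, hW, sum_biUnion hdisJ]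
      rfl
    have h2 : ∑ V ∈ J, 2 * V.card ≤ ∑ V ∈ J, (∑ x ∈ V, (N x).card + 1) :=
      sum_le_sum fun V hV => hP.edges V (hJP hV)
    rw [← mul_sum, ← hWcard, sum_add_distrib, ← card_eq_sum_ones] at h2
    omega
  · rw [biUnion_insert, id, hV₀, insert_union, hW, ← union_biUnion, union_sdiff_of_subset hJP]

open Finset in
/-- A local-search bound of Hurkens–Schrijver type: if every small set of vertices of `B` has at
least as many neighbours in `A` as elements, then `2 * #B - k * #A` is at most `#B / s`. -/
theorem exists_two_mul_card_le_of_local_expansion {α β : Type*} [DecidableEq α] [DecidableEq β]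
    {N : β → Finset α} {A : Finset α} {B : Finset β} {k s : ℕ} (hk : 2 ≤ k) (hs : 1 ≤ s)
    (hNA : ∀ b ∈ B, N b ⊆ A) (hN : ∀ b ∈ B, (N b).card ≤ k)
    (hdeg : ∀ a ∈ A, (B.filter (fun b => a ∈ N b)).card ≤ k)
    (hloc : ∀ V ⊆ B, V.card ≤ 2 * (k * (s - 1) + 1) → V.card ≤ (V.biUnion N).card) :
    ∃ L : ℕ, s * L ≤ B.card ∧ 2 * B.card ≤ k * A.card + L := by
  classical
  obtain ⟨P, hPmem, hmax⟩ := exists_max_image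
    (B.powerset.powerset.filter (fun P => IsTightFamily N (k * (s - 1) + 1) P))
    (fun P => (P.biUnion id).card)
    ⟨∅, by simpa using IsTightFamily.mk (by simp) (by simp) (by simp) (by simp) (by simp)⟩
  obtain ⟨hPB, hP⟩ := mem_filter.1 hPmem
  have hVB : ∀ V ∈ P, V ⊆ B := fun V hV => mem_powerset.1 (mem_powerset.1 hPB hV)
  have hUB : P.biUnion id ⊆ B := biUnion_subset.2 hVB
  set U := P.biUnion id with hU
  set Ps := P.filter (fun V => V.card < s) with hPs
  set Pl := P.filter (fun V => ¬ V.card < s) with hPl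
  set As := Ps.biUnion (fun V => V.biUnion N) with hAs
  have hrest : ∀ b ∈ B \ U, 2 ≤ (N b \ As).card := by
    intro b hb
    obtain ⟨hb, hbU⟩ := mem_sdiff.1 hb
    by_contra! hfew
    obtain ⟨Q, hQ, hQU⟩ := hP.exists_merge hs hN hloc hUB hb hbU hfew
    have hQB : Q.biUnion id ⊆ B := hQU ▸ insert_subset hb hUB
    have := hmax Q (mem_filter.2 ⟨mem_powerset.2 fun V hV => mem_powerset.2
      ((subset_biUnion_of_mem id hV).trans hQB), hQ⟩)
    rw [hQU, card_insert_of_notMem hbU] at this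
    omega
  have hUcard : U.card = ∑ V ∈ Ps, V.card + ∑ V ∈ Pl, V.card := by
    rw [hU, card_biUnion hP.disjoint, hPs, hPl, sum_filter_add_sum_filter_not]
    rfl
  have hBcard := card_sdiff_add_card_eq_card hUB
  have hAsA : As ⊆ A := biUnion_subset.2 fun V hV => biUnion_subset.2 fun b hb =>
    hNA b (hVB V (mem_filter.1 hV).1 hb)
  have hAscard : As.card = ∑ V ∈ Ps, V.card := by
    rw [hAs, card_biUnion]
    · exact sum_congr rfl fun V hV => hP.tight V (mem_filter.1 hV).1
    · exact fun V hV V' hV' h => hP.disjoint_nbhd (mem_filter.1 hV).1 (mem_filter.1 hV').1 h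
  have hAcard := card_sdiff_add_card_eq_card hAsA
  have hdouble : ∑ b ∈ B, (N b \ As).card ≤ k * (A \ As).card := by
    have h1 : ∀ b ∈ B, (N b \ As).card = ((A \ As).filter (fun a => a ∈ N b)).card := by
      intro b hb
      congr 1
      ext a
      have := @hNA b hb a
      simp only [mem_sdiff, mem_filter]
      tauto
    rw [sum_congr rfl h1]
    have h2 := sum_card_bipartiteAbove_eq_sum_card_bipartiteBelow (s := B) (t := A \ As)
      (fun b a => a ∈ N b)
    unfold bipartiteAbove bipartiteBelow at h2
    rw [h2, mul_comm]
    exact sum_le_card_nsmul _ _ _ fun a ha => hdeg a (mem_sdiff.1 ha).1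
  have hlarge : ∀ V ∈ Pl, ∀ b ∈ V, N b \ As = N b := by
    intro V hV b hb
    obtain ⟨hVP, hVs⟩ := mem_filter.1 hV
    refine sdiff_eq_self_of_disjoint ?_
    rw [hAs, disjoint_biUnion_right]
    intro V' hV'
    obtain ⟨hVP', hVs'⟩ := mem_filter.1 hV'
    exact (hP.disjoint_nbhd hVP hVP' (fun h => hVs (h ▸ hVs'))).mono_left
      (subset_biUnion_of_mem N hb)
  have hUsum : ∑ V ∈ Pl, ∑ b ∈ V, (N b).card ≤ ∑ b ∈ U, (N b \ As).card := by
    rw [hU, sum_biUnion hP.disjoint, ← sum_filter_add_sum_filter_not P (fun V => V.card < s)]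
    refine le_add_left (sum_le_sum fun V hV => (sum_congr rfl fun b hb => ?_).le)
    rw [hlarge V hV b hb]
  have hrsum : 2 * (B \ U).card ≤ ∑ b ∈ B \ U, (N b \ As).card := by
    rw [mul_comm]
    exact card_nsmul_le_sum _ _ _ hrest
  have hBsum := sum_sdiff (f := fun b => (N b \ As).card) hUB
  have hedges : ∑ V ∈ Pl, 2 * V.card ≤ ∑ V ∈ Pl, (∑ b ∈ V, (N b).card + 1) :=
    sum_le_sum fun V hV => hP.edges V (mem_filter.1 hV).1
  rw [← mul_sum, sum_add_distrib, ← card_eq_sum_ones] at hedges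
  have hkAs : 2 * As.card ≤ k * As.card := Nat.mul_le_mul_right _ hk
  refine ⟨Pl.card, ?_, ?_⟩
  · have : Pl.card * s ≤ ∑ V ∈ Pl, V.card :=
      card_nsmul_le_sum _ _ _ fun V hV => not_lt.1 (mem_filter.1 hV).2
    rw [mul_comm]
    omega
  · rw [← hAcard, mul_add]
    omega

open Finset in
/-- At most `#x` members of a packing meet the set `x`. -/
theorem card_filter_inter_nonempty_le_s2 {α : Type*} [DecidableEq α] {F : Finset (Finset α)}
    (hF : ∀ s ∈ F, ∀ t ∈ F, s ≠ t → Disjoint s t) (x : Finset α) :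
    (F.filter (fun s => (x ∩ s).Nonempty)).card ≤ x.card := by
  have h1 : ∑ s ∈ F.filter (fun s => (x ∩ s).Nonempty), (x ∩ s).card ≤ x.card := by
    rw [← card_biUnion fun s hs t ht h => (hF s (mem_filter.1 hs).1 t (mem_filter.1 ht).1 h).mono
      inter_subset_right inter_subset_right]
    exact card_le_card (biUnion_subset.2 fun s _ => inter_subset_left)
  refine le_trans ?_ h1
  rw [card_eq_sum_ones]
  exact sum_le_sum fun s hs => (mem_filter.1 hs).2.card_pos

open Finset in
/-- There is a set of slots `(a, inr j)` with `1 ≤ j ≤ n a` and `(a, inl b)` with `a ∈ M b`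
containing all of these, and its size is the sum of the numbers of slots. -/
theorem exists_slots {α β : Type*} [DecidableEq α] [DecidableEq β] (A : Finset α) (B : Finset β)
    (n : α → ℕ) (M : β → Finset α) :
    ∃ Q : Finset (α × (β ⊕ ℕ)), Q.card = ∑ a ∈ A, n a + ∑ b ∈ B, (M b).card ∧
      (∀ a b, (a, Sum.inl b) ∈ Q → b ∈ B ∧ a ∈ M b) ∧
      (∀ a j, (a, Sum.inr j) ∈ Q → a ∈ A ∧ 1 ≤ j ∧ j ≤ n a) := by
  refine ⟨(A.sigma fun a => Icc 1 (n a)).image (fun p => (p.1, Sum.inr p.2)) ∪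
    (B.sigma M).image (fun p => (p.2, Sum.inl p.1)), ?_, ?_, ?_⟩
  · rw [card_union_of_disjoint, card_image_of_injective, card_image_of_injective, card_sigma,
      card_sigma]
    · simp
    · rintro ⟨b, a⟩ ⟨b', a'⟩ h
      simp_all
    · rintro ⟨a, j⟩ ⟨a', j'⟩ h
      simp_all
    · rw [disjoint_left]
      simp
  · simp
  · simp

open Finset in
/-- Lemma 1 of the paper: There is a constant `c > 0` such that for all
`k ≥ 3`, `ε ∈ (0,1)`, and disjoint finite packings `A`, `B` of `k`-element sets such
that every `V ⊆ B` with `|V| ≤ c·k/ε` intersects at least `|V|` sets of `A`, there are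
a subset `S` of `B₁¹ = {b ∈ B : deg b = 1}` with `|B₁¹ \ S| ≤ ε·|B|` and an injection
`f` from `S` into the surplus slots (a surplus slot is either a null edge `(a, j)` of
`a ∈ A` with `1 ≤ j ≤ k − deg a`, or a surplus edge `(a, b)` with `a ∈ A`, `b ∈ B`,
`a ∩ b ≠ ∅`, `deg b ≥ 3`), such that each `b ∈ B` of degree at least `3` receives at
most `deg b − 2` surplus edges, i.e. keeps degree at least `2` after the matching. -/
theorem stmt_2 :
    ∃ c : ℝ, 0 < c ∧
      ∀ (k : ℕ), 3 ≤ k → ∀ (ε : ℝ), 0 < ε → ε < 1 →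
      ∀ (α : Type) [DecidableEq α] (A B : Finset (Finset α)),
        (∀ s ∈ A, s.card = k) →
        (∀ s ∈ B, s.card = k) →
        Disjoint A B →
        (∀ a₁ ∈ A, ∀ a₂ ∈ A, a₁ ≠ a₂ → Disjoint a₁ a₂) →
        (∀ b₁ ∈ B, ∀ b₂ ∈ B, b₁ ≠ b₂ → Disjoint b₁ b₂) →
        (∀ V ⊆ B, (V.card : ℝ) ≤ c * k / ε →
          V.card ≤ (A.filter (fun a => ∃ v ∈ V, (a ∩ v).Nonempty)).card) →
        ∃ (S : Finset (Finset α)) (f : Finset α → Finset α × (Finset α ⊕ ℕ)),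
          S ⊆ B.filter (fun b => (A.filter (fun a => (a ∩ b).Nonempty)).card = 1) ∧
          (((B.filter (fun b => (A.filter (fun a => (a ∩ b).Nonempty)).card = 1))
              \ S).card : ℝ) ≤ ε * B.card ∧
          Set.InjOn f ↑S ∧
          (∀ s ∈ S, (f s).1 ∈ A ∧
            (match (f s).2 with
             | Sum.inl b => b ∈ B ∧ ((f s).1 ∩ b).Nonempty ∧
                 3 ≤ (A.filter (fun a => (a ∩ b).Nonempty)).card
             | Sum.inr j => 1 ≤ j ∧
                 j ≤ k - (B.filter (fun b => ((f s).1 ∩ b).Nonempty)).card)) ∧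
          (∀ b ∈ B, 3 ≤ (A.filter (fun a => (a ∩ b).Nonempty)).card →
            (S.filter (fun s => (f s).2 = Sum.inl b)).card ≤
              (A.filter (fun a => (a ∩ b).Nonempty)).card - 2) := by
  refine ⟨4, by norm_num, ?_⟩
  intro k hk ε hε hε1 α _ A B hA hB _ hAdis hBdis hloc
  set N : Finset α → Finset (Finset α) := fun b => A.filter (fun a => (a ∩ b).Nonempty) with hNdef
  have hNcard : ∀ b ∈ B, (N b).card ≤ k := fun b hb => by
    have := card_filter_inter_nonempty_le_s2 hAdis b
    simp only [inter_comm b, hB b hb] at this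
    exact this
  have hdegA : ∀ a ∈ A, (B.filter (fun b => (a ∩ b).Nonempty)).card ≤ k := fun a ha =>
    (card_filter_inter_nonempty_le_s2 hBdis a).trans (hA a ha).le
  have hmemN : ∀ a ∈ A, ∀ b, a ∈ N b ↔ (a ∩ b).Nonempty := fun a ha b => by
    simp [hNdef, ha]
  obtain ⟨L, hL, hcount⟩ : ∃ L : ℕ, ⌈ε⁻¹⌉₊ * L ≤ B.card ∧ 2 * B.card ≤ k * A.card + L := by
    have hs : 1 ≤ ⌈ε⁻¹⌉₊ := Nat.one_le_ceil_iff.2 (by positivity)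
    refine exists_two_mul_card_le_of_local_expansion (N := N) (by omega) hs
      (fun b _ => filter_subset _ _) hNcard ?_ ?_
    · intro a ha
      simpa only [hmemN a ha] using hdegA a ha
    · intro V hV hVc
      have hV' : (V.card : ℝ) ≤ 4 * k / ε := by
        have h1 : (V.card : ℝ) ≤ 2 * (k * ((⌈ε⁻¹⌉₊ : ℝ) - 1) + 1) := by
          have h0 : (V.card : ℝ) ≤ 2 * (k * ((⌈ε⁻¹⌉₊ - 1 : ℕ) : ℝ) + 1) := by exact_mod_cast hVc
          rwa [Nat.cast_sub hs, Nat.cast_one] at h0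
        have h2 : (⌈ε⁻¹⌉₊ : ℝ) - 1 ≤ ε⁻¹ := by
          linarith [Nat.ceil_lt_add_one (a := ε⁻¹) (by positivity)]
        have h3 : (1 : ℝ) ≤ ε⁻¹ := (one_le_inv₀ hε).2 hε1.le
        have h4 : (3 : ℝ) ≤ k := by exact_mod_cast hk
        have h5 : (k : ℝ) * ((⌈ε⁻¹⌉₊ : ℝ) - 1) ≤ k * ε⁻¹ := by gcongr
        rw [div_eq_mul_inv]
        nlinarith
      convert hloc V hV hV' using 2
      ext a
      simp only [hNdef, mem_biUnion, mem_filter]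
      tauto
  have hLε : (L : ℝ) ≤ ε * B.card := by
    have h1 : (⌈ε⁻¹⌉₊ : ℝ) * L ≤ B.card := by exact_mod_cast hL
    have h2 : ε⁻¹ * L ≤ B.card := le_trans (by gcongr; exact Nat.le_ceil _) h1
    rwa [inv_mul_le_iff₀ hε] at h2
  have hM : ∀ b, ∃ M ⊆ N b, M.card = (N b).card - 2 := fun b =>
    exists_subset_card_eq (Nat.sub_le _ _)
  choose M hMN hMcard using hM
  obtain ⟨Q, hQcard, hQl, hQr⟩ := exists_slots A B
    (fun a => k - (B.filter (fun b => (a ∩ b).Nonempty)).card) M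
  set B₁ := B.filter (fun b => (N b).card = 1) with hB₁
  have hsurplus : B₁.card ≤ Q.card + L := by
    have h1 : ∑ a ∈ A, (k - (B.filter (fun b => (a ∩ b).Nonempty)).card) +
        ∑ b ∈ B, (N b).card = k * A.card := by
      have h2 := sum_card_bipartiteAbove_eq_sum_card_bipartiteBelow (s := A) (t := B)
        (fun a b => (a ∩ b).Nonempty)
      unfold bipartiteAbove bipartiteBelow at h2
      rw [← h2, ← sum_add_distrib, sum_congr rfl fun a ha => Nat.sub_add_cancel (hdegA a ha)]
      simp [mul_comm]
    have h3 : ∑ b ∈ B, (N b).card + B₁.card ≤ 2 * B.card + ∑ b ∈ B, (M b).card := by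
      rw [hB₁, card_filter, ← sum_add_distrib, mul_comm, ← smul_eq_mul, ← sum_const,
        ← sum_add_distrib]
      refine sum_le_sum fun b _ => ?_
      rw [hMcard]
      split_ifs <;> omega
    omega
  obtain ⟨S, hSB, hScard⟩ := exists_subset_card_eq (min_le_left B₁.card Q.card)
  obtain ⟨f, hfQ, hfinj⟩ : ∃ f : Finset α → Finset α × (Finset α ⊕ ℕ),
      (∀ s ∈ S, f s ∈ Q) ∧ Set.InjOn f S := by
    obtain ⟨e⟩ := Function.Embedding.nonempty_of_card_le (α := S) (β := Q) (by
      simp only [Fintype.card_coe]; omega)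
    refine ⟨fun s => if h : s ∈ S then (e ⟨s, h⟩ : Finset α × (Finset α ⊕ ℕ)) else (∅, Sum.inr 0),
      fun s hs => by simp [hs], fun s hs t ht h => ?_⟩
    have hs' : s ∈ S := hs
    have ht' : t ∈ S := ht
    simpa [hs', ht', Subtype.coe_inj] using h
  refine ⟨S, f, hSB, ?_, hfinj, ?_, ?_⟩
  · refine le_trans ?_ hLε
    rw [card_sdiff_of_subset hSB]
    exact_mod_cast (by omega : B₁.card - S.card ≤ L)
  · intro s hs
    have hfs := hfQ s hs
    rcases hf : f s with ⟨a, b | j⟩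
    · rw [hf] at hfs
      obtain ⟨hb, ha⟩ := hQl a b hfs
      obtain ⟨haA, hab⟩ := mem_filter.1 (hMN b ha)
      have := card_pos.2 ⟨a, ha⟩
      rw [hMcard] at this
      exact ⟨haA, hb, hab, by change 3 ≤ (N b).card; omega⟩
    · rw [hf] at hfs
      obtain ⟨haA, h1, h2⟩ := hQr a j hfs
      exact ⟨haA, h1, h2⟩
  · intro b _ _
    change _ ≤ (N b).card - 2
    rw [← hMcard]
    refine card_le_card_of_injOn (fun s => (f s).1) ?_ ?_
    · intro s hs
      obtain ⟨hs, hsb⟩ := mem_filter.1 hs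
      have := hfQ s hs
      rw [← Prod.mk.eta (p := f s), hsb] at this
      exact (hQl _ _ this).2
    · intro s hs t ht h
      obtain ⟨hs, hsb⟩ := mem_filter.1 hs
      obtain ⟨ht, htb⟩ := mem_filter.1 ht
      exact hfinj hs ht (Prod.ext h (hsb.trans htb.symm))
end

section
/- Let M be a finite set with |M| = 3s, let W ⊆ M with |W| = w, and let r ≤ s be a natural number. Then the number of pairs (P, F), where P is a partition of M into parts each of cardinality exactly 3 and F is an r-element set of parts of P with every part in F contained in W, equals C(w, 3r) · ((3r)! / (6^r · r!)) · ((3(s−r))! / (6^{s−r} · (s−r)!)). -/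
open Finset

/-- `P` is a partition of `M` into parts of cardinality `k`. -/
def IsUniformPartition {α : Type*} [DecidableEq α] (k : ℕ) (M : Finset α)
    (P : Finset (Finset α)) : Prop :=
  (∀ p ∈ P, p.card = k) ∧ (∀ p ∈ P, ∀ q ∈ P, p ≠ q → Disjoint p q) ∧ P.sup id = M

namespace IsUniformPartition

variable {α : Type*} [DecidableEq α] {k : ℕ} {M U : Finset α} {P F G : Finset (Finset α)}

lemma subset (h : IsUniformPartition k M P) {p : Finset α} (hp : p ∈ P) : p ⊆ M :=
  h.2.2 ▸ le_sup (f := id) hp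

lemma subset_powerset (h : IsUniformPartition k M P) : P ⊆ M.powerset :=
  fun _ hp => mem_powerset.2 (h.subset hp)

lemma card_mul (h : IsUniformPartition k M P) : P.card * k = M.card := by
  rw [← h.2.2, sup_eq_biUnion, card_biUnion (t := id) h.2.1]
  exact (sum_const_nat h.1).symm

lemma of_subset (h : IsUniformPartition k M P) (hF : F ⊆ P) :
    IsUniformPartition k (F.sup id) F :=
  ⟨fun p hp => h.1 p (hF hp), fun p hp q hq => h.2.1 p (hF hp) q (hF hq), rfl⟩

lemma sdiff (h : IsUniformPartition k M P) (hF : F ⊆ P) :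
    IsUniformPartition k (M \ F.sup id) (P \ F) := by
  have hs := h.of_subset (F := P \ F) sdiff_subset
  have hd : Disjoint ((P \ F).sup id) (F.sup id) := by
    simp only [Finset.disjoint_sup_left, Finset.disjoint_sup_right, mem_sdiff, id]
    intro q hq p hp
    exact h.2.1 _ hp.1 _ (hF hq) fun e => hp.2 (e ▸ hq)
  have hM : M = (P \ F).sup id ∪ F.sup id := by
    rw [← sup_eq_union, ← sup_union, sdiff_union_of_subset hF, h.2.2]
  rwa [hM, union_sdiff_cancel_right hd]

lemma union (hF : IsUniformPartition k U F) (hG : IsUniformPartition k (M \ U) G)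
    (hU : U ⊆ M) : IsUniformPartition k M (F ∪ G) := by
  have hd : ∀ p ∈ F, ∀ q ∈ G, Disjoint p q := fun p hp q hq =>
    disjoint_sdiff.mono (hF.subset hp) (hG.subset hq)
  refine ⟨?_, ?_, ?_⟩
  · intro p hp
    exact (mem_union.1 hp).elim (hF.1 p) (hG.1 p)
  · intro p hp q hq hpq
    rcases mem_union.1 hp with hp | hp <;> rcases mem_union.1 hq with hq | hq
    · exact hF.2.1 p hp q hq hpq
    · exact hd p hp q hq
    · exact (hd q hq p hp).symm
    · exact hG.2.1 p hp q hq hpq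
  · rw [sup_union, hF.2.2, hG.2.2, sup_eq_union, union_sdiff_of_subset hU]

lemma union_sdiff_left (hk : 0 < k) (hF : IsUniformPartition k U F)
    (hG : IsUniformPartition k (M \ U) G) : (F ∪ G) \ F = G := by
  refine union_sdiff_cancel_left (disjoint_left.2 fun p hpF hpG => ?_)
  have hp : Disjoint p p := disjoint_sdiff.mono (hF.subset hpF) (hG.subset hpG)
  have := hF.1 p hpF
  rw [disjoint_self_iff_empty] at hp
  simp_all

end IsUniformPartition

section UniformPartitions

variable {α : Type*} [DecidableEq α] {k : ℕ}

open scoped Classical in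
/-- The finite set of partitions of `M` into parts of cardinality `k`. -/
noncomputable def uniformPartitions (k : ℕ) (M : Finset α) : Finset (Finset (Finset α)) :=
  M.powerset.powerset.filter (IsUniformPartition k M)

lemma mem_uniformPartitions {M : Finset α} {P : Finset (Finset α)} :
    P ∈ uniformPartitions k M ↔ IsUniformPartition k M P := by
  simp only [uniformPartitions, mem_filter, mem_powerset, and_iff_right_iff_imp]
  exact IsUniformPartition.subset_powerset

/-- Choosing a partition together with `r` of its parts inside `W` amounts to choosing the union
`U` of these parts, a partition of `U`, and a partition of `M \ U`. -/
lemma sum_card_filter_powersetCard (hk : 0 < k) {M W : Finset α} (hW : W ⊆ M) (r : ℕ) :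
    ∑ P ∈ uniformPartitions k M, ((P.powersetCard r).filter fun F => ∀ p ∈ F, p ⊆ W).card =
      ∑ U ∈ W.powersetCard (k * r),
        (uniformPartitions k U).card * (uniformPartitions k (M \ U)).card := by
  simp_rw [← card_product]
  rw [← card_sigma, ← card_sigma]
  refine card_nbij' (fun x => ⟨x.2.sup id, x.2, x.1 \ x.2⟩) (fun y => ⟨y.2.1 ∪ y.2.2, y.2.1⟩)
    ?_ ?_ ?_ ?_
  · rintro ⟨P, F⟩ h
    simp only [coe_sigma, Set.mem_sigma_iff, mem_coe, mem_filter, mem_powersetCard,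
      mem_product, mem_uniformPartitions] at h ⊢
    obtain ⟨hP, ⟨hF, hr⟩, hFW⟩ := h
    have hF' := hP.of_subset hF
    exact ⟨⟨Finset.sup_le hFW, by rw [← hF'.card_mul, hr, mul_comm]⟩, hF', hP.sdiff hF⟩
  · rintro ⟨U, F, G⟩ h
    simp only [coe_sigma, Set.mem_sigma_iff, mem_coe, mem_filter, mem_powersetCard,
      mem_product, mem_uniformPartitions] at h ⊢
    obtain ⟨⟨hUW, hU⟩, hF, hG⟩ := h
    refine ⟨hF.union hG (hUW.trans hW), ⟨subset_union_left, ?_⟩,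
      fun p hp => (hF.subset hp).trans hUW⟩
    exact Nat.eq_of_mul_eq_mul_left hk (by rw [mul_comm, hF.card_mul, hU])
  · rintro ⟨P, F⟩ h
    simp only [coe_sigma, Set.mem_sigma_iff, mem_coe, mem_filter, mem_powersetCard] at h
    simp [union_sdiff_of_subset h.2.1.1]
  · rintro ⟨U, F, G⟩ h
    simp only [coe_sigma, Set.mem_sigma_iff, mem_coe, mem_product, mem_uniformPartitions] at h
    obtain ⟨-, hF, hG⟩ := h
    obtain rfl := hF.2.2
    simp [hF.union_sdiff_left hk hG]

lemma uniformPartitions_empty (hk : 0 < k) : uniformPartitions k (∅ : Finset α) = {∅} := by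
  ext P
  rw [mem_uniformPartitions, mem_singleton]
  refine ⟨fun h => ?_, ?_⟩
  · simpa [hk.ne'] using h.card_mul
  · rintro rfl
    simp [IsUniformPartition]

lemma uniformPartitions_of_card_eq (hk : 0 < k) {U : Finset α} (hU : U.card = k) :
    uniformPartitions k U = {{U}} := by
  ext P
  rw [mem_uniformPartitions, mem_singleton]
  refine ⟨fun h => ?_, ?_⟩
  · have hP : P.card = 1 := Nat.eq_of_mul_eq_mul_right hk (by rw [h.card_mul, hU, one_mul])
    obtain ⟨p, rfl⟩ := card_eq_one.1 hP
    simpa using h.2.2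
  · rintro rfl
    simp [IsUniformPartition, hU]

lemma card_uniformPartitions_mul (hk : 0 < k) (m : ℕ) {M : Finset α} (hM : M.card = k * m) :
    (uniformPartitions k M).card * (k.factorial ^ m * m.factorial) = (k * m).factorial := by
  induction m generalizing M with
  | zero =>
    obtain rfl : M = ∅ := by simpa using hM
    simp [uniformPartitions_empty hk]
  | succ m ih =>
    have hleft : ∀ P ∈ uniformPartitions k M,
        ((P.powersetCard 1).filter fun F => ∀ p ∈ F, p ⊆ M).card = m + 1 := by
      intro P hP
      rw [mem_uniformPartitions] at hP
      rw [filter_true_of_mem fun F hF p hp => hP.subset ((mem_powersetCard.1 hF).1 hp),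
        card_powersetCard, Nat.choose_one_right]
      exact Nat.eq_of_mul_eq_mul_left hk (by rw [mul_comm, hP.card_mul, hM])
    have hright : ∀ U ∈ M.powersetCard (k * 1),
        (uniformPartitions k U).card * (uniformPartitions k (M \ U)).card *
          (k.factorial ^ m * m.factorial) = (k * m).factorial := by
      intro U hU
      rw [mem_powersetCard, mul_one] at hU
      rw [uniformPartitions_of_card_eq hk hU.2, card_singleton, one_mul]
      refine ih ?_
      rw [card_sdiff_of_subset hU.1, hM, hU.2, mul_add_one, Nat.add_sub_cancel]
    have key := sum_card_filter_powersetCard hk (subset_refl M) 1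
    rw [sum_const_nat hleft] at key
    calc
      _ = (uniformPartitions k M).card * (m + 1) * (k.factorial ^ m * m.factorial) *
          k.factorial := by
        rw [pow_succ, Nat.factorial_succ]
        ring
      _ = (k * (m + 1)).choose k * k.factorial * (k * m).factorial := by
        rw [key, sum_mul, sum_const_nat hright, card_powersetCard, hM, mul_one]
        ring
      _ = (k * (m + 1)).factorial := by
        have h := Nat.choose_mul_factorial_mul_factorial (Nat.le_mul_of_pos_right k m.succ_pos)
        rwa [Nat.succ_eq_add_one, mul_add_one, Nat.add_sub_cancel, ← mul_add_one] at h

lemma card_uniformPartitions (hk : 0 < k) (m : ℕ) {M : Finset α} (hM : M.card = k * m) :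
    ((uniformPartitions k M).card : ℝ) =
      (k * m).factorial / ((k.factorial : ℝ) ^ m * m.factorial) := by
  rw [eq_div_iff (by positivity)]
  exact_mod_cast card_uniformPartitions_mul hk m hM

end UniformPartitions


/-- Let `|M| = 3s`, `W ⊆ M` with `|W| = w`, and `r ≤ s`. The number of
pairs `(P, F)` where `P` is a partition of `M` into parts of cardinality exactly `3`
and `F` is an `r`-element set of parts of `P` all contained in `W` equals
`C(w, 3r) · ((3r)!/(6^r·r!)) · ((3(s−r))!/(6^(s−r)·(s−r)!))`. -/
theorem stmt_4 {α : Type} [DecidableEq α] (s w r : ℕ) (M W : Finset α)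
    (hM : M.card = 3 * s) (hW : W ⊆ M) (hw : W.card = w) (hr : r ≤ s) :
    (((M.powerset.powerset ×ˢ M.powerset.powerset).filter
        (fun PF : Finset (Finset α) × Finset (Finset α) =>
          (∀ p ∈ PF.1, p.card = 3) ∧
          (∀ p ∈ PF.1, ∀ q ∈ PF.1, p ≠ q → Disjoint p q) ∧
          PF.1.sup id = M ∧
          PF.2 ⊆ PF.1 ∧
          PF.2.card = r ∧
          (∀ p ∈ PF.2, p ⊆ W))).card : ℝ)
      = (w.choose (3 * r)) *
        ((Nat.factorial (3 * r)) / (6 ^ r * Nat.factorial r)) *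
        ((Nat.factorial (3 * (s - r))) / (6 ^ (s - r) * Nat.factorial (s - r))) := by
  have hsum : ((M.powerset.powerset ×ˢ M.powerset.powerset).filter
        (fun PF : Finset (Finset α) × Finset (Finset α) =>
          (∀ p ∈ PF.1, p.card = 3) ∧
          (∀ p ∈ PF.1, ∀ q ∈ PF.1, p ≠ q → Disjoint p q) ∧
          PF.1.sup id = M ∧
          PF.2 ⊆ PF.1 ∧
          PF.2.card = r ∧
          (∀ p ∈ PF.2, p ⊆ W))).card =
      ∑ P ∈ uniformPartitions 3 M,
        ((P.powersetCard r).filter fun F => ∀ p ∈ F, p ⊆ W).card := by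
    rw [← card_sigma]
    refine card_nbij' (fun x => ⟨x.1, x.2⟩) (fun y => (y.1, y.2)) ?_ ?_
      (fun _ _ => rfl) (fun _ _ => rfl)
    · rintro ⟨P, F⟩ h
      simp only [coe_filter, Set.mem_ofPred_eq] at h
      obtain ⟨-, h₁, h₂, h₃, hF, hc, hFW⟩ := h
      simp only [coe_sigma, Set.mem_sigma_iff, mem_coe, mem_filter, mem_powersetCard,
        mem_uniformPartitions]
      exact ⟨⟨h₁, h₂, h₃⟩, ⟨hF, hc⟩, hFW⟩
    · rintro ⟨P, F⟩ h
      simp only [coe_sigma, Set.mem_sigma_iff, mem_coe, mem_filter, mem_powersetCard,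
        mem_uniformPartitions] at h
      obtain ⟨hP, ⟨hF, hc⟩, hFW⟩ := h
      simp only [coe_filter, Set.mem_ofPred_eq, mem_product, mem_powerset]
      exact ⟨⟨hP.subset_powerset, hF.trans hP.subset_powerset⟩, hP.1, hP.2.1, hP.2.2, hF, hc,
        hFW⟩
  have hterm : ∀ U ∈ W.powersetCard (3 * r),
      ((uniformPartitions 3 U).card : ℝ) * (uniformPartitions 3 (M \ U)).card =
        ((Nat.factorial (3 * r)) / (6 ^ r * Nat.factorial r)) *
        ((Nat.factorial (3 * (s - r))) / (6 ^ (s - r) * Nat.factorial (s - r))) := by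
    intro U hU
    rw [mem_powersetCard] at hU
    have hMU : (M \ U).card = 3 * (s - r) := by
      rw [card_sdiff_of_subset (hU.1.trans hW), hM, hU.2, Nat.mul_sub]
    rw [card_uniformPartitions three_pos r hU.2, card_uniformPartitions three_pos (s - r) hMU]
    norm_num [Nat.factorial_succ 2]
  rw [hsum, sum_card_filter_powersetCard three_pos hW]
  push_cast
  rw [sum_congr rfl hterm, sum_const, card_powersetCard, hw, nsmul_eq_mul, mul_assoc]
end

section
/- Let a and k be real numbers with 0 < k ≤ e³·a, and set t₀ = (e³·a/k)^{1/5}. Then the double sum Σ_{t=1}^{⌊t₀⌋} Σ_{r=1}^{t} ( k·t⁴ / (3·e³·a) )^r is strictly less than 1. -/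
/-- A truncated geometric sum without constant term is at most twice its ratio when the ratio
lies in `[0, 1/2]`. -/
theorem sum_Icc_one_pow_le_two_mul {x : ℝ} (hx : 0 ≤ x) (hx' : x ≤ 1 / 2) (n : ℕ) :
    ∑ r ∈ Finset.Icc 1 n, x ^ r ≤ 2 * x := by
  have geom : (∑ r ∈ Finset.Icc 1 n, x ^ r) * (1 - x) = x - x ^ (n + 1) := by
    induction n with
    | zero => simp
    | succ n ih =>
      rw [Finset.sum_Icc_succ_top (by omega), add_mul, ih]
      ring
  have hpow : 0 ≤ x ^ (n + 1) := by positivity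
  have hsum : 0 ≤ ∑ r ∈ Finset.Icc 1 n, x ^ r := Finset.sum_nonneg fun r _ => by positivity
  nlinarith

/-- For reals `0 < k ≤ e³·a` and `t₀ = (e³·a/k)^(1/5)`,
`Σ_{t=1}^{⌊t₀⌋} Σ_{r=1}^{t} (k·t⁴/(3e³a))^r < 1`. -/
theorem stmt_7 (a k : ℝ) (hk : 0 < k) (hka : k ≤ Real.exp 3 * a) :
    ∑ t ∈ Finset.Icc 1 (Nat.floor ((Real.exp 3 * a / k) ^ ((1 : ℝ) / 5))),
      ∑ r ∈ Finset.Icc 1 t,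
        (k * (t : ℝ) ^ 4 / (3 * Real.exp 3 * a)) ^ r < 1 := by
  have hb : 0 < Real.exp 3 * a := hk.trans_le hka
  have hq : 1 ≤ Real.exp 3 * a / k := (one_le_div hk).2 hka
  set T : ℝ := (Real.exp 3 * a / k) ^ ((1 : ℝ) / 5) with hT
  have hT1 : 1 ≤ T := Real.one_le_rpow hq (by norm_num)
  have hT0 : 0 < T := one_pos.trans_le hT1
  have hT5 : T ^ 5 = Real.exp 3 * a / k := by
    rw [hT, ← Real.rpow_natCast, ← Real.rpow_mul (by positivity)]
    norm_num
  have hbT : Real.exp 3 * a = k * T ^ 5 := by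
    rw [hT5]
    field_simp
  have inner_le : ∀ t ∈ Finset.Icc 1 ⌊T⌋₊,
      ∑ r ∈ Finset.Icc 1 t, (k * (t : ℝ) ^ 4 / (3 * Real.exp 3 * a)) ^ r ≤ 2 / (3 * T) := by
    intro t ht
    have htT : (t : ℝ) ≤ T := (Nat.le_floor_iff hT0.le).1 (Finset.mem_Icc.1 ht).2
    have hratio : k * (t : ℝ) ^ 4 / (3 * Real.exp 3 * a) ≤ 1 / (3 * T) := by
      calc k * (t : ℝ) ^ 4 / (3 * Real.exp 3 * a)
          ≤ k * T ^ 4 / (3 * (k * T ^ 5)) := by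
            rw [mul_assoc 3, hbT]
            gcongr
        _ = 1 / (3 * T) := by field_simp
    have hnonneg : 0 ≤ k * (t : ℝ) ^ 4 / (3 * Real.exp 3 * a) := by
      rw [mul_assoc 3]
      positivity
    have hhalf : 1 / (3 * T) ≤ 1 / 2 := by
      gcongr
      linarith
    calc _ ≤ 2 * (k * (t : ℝ) ^ 4 / (3 * Real.exp 3 * a)) :=
          sum_Icc_one_pow_le_two_mul hnonneg (hratio.trans hhalf) t
      _ ≤ 2 * (1 / (3 * T)) := by gcongr
      _ = 2 / (3 * T) := by ring
  calc _ ≤ ∑ t ∈ Finset.Icc 1 ⌊T⌋₊, 2 / (3 * T) := Finset.sum_le_sum inner_le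
    _ = ⌊T⌋₊ * (2 / (3 * T)) := by simp
    _ ≤ T * (2 / (3 * T)) := by
        gcongr
        exact Nat.floor_le hT0.le
    _ = 2 / 3 := by field_simp
    _ < 1 := by norm_num
end
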